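/- arXiv:1605.09335 — 4 statements merged into one kernel-verified Lean document; each statement's English description precedes it below -/
import Mathlib

section
/- Fix γ > −1/2 and τ ∈ ℝ, and let μ̃ be the Hua–Pickrell measure. Then K_n(1,1; μ̃) = (n^{2γ+1}/Γ(2γ+2))·(1+o(1)) as n → ∞; equivalently, lim_{n→∞} Γ(2γ+2)·K_n(1,1; μ̃)/n^{2γ+1} = 1. -/
open MeasureTheory Filter Set Topology ComplexConjugate

noncomputable section

/-- Rising factorial (Pochhammer symbol) `(v)_k`. -/
def risingFac (v : ℂ) (k : ℕ) : ℂ := (ascPochhammer ℂ k).eval v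

/-- Real rising factorial. -/
def risingFacR (v : ℝ) (k : ℕ) : ℝ := (ascPochhammer ℝ k).eval v

/-- The confluent hypergeometric function `₁F₁(a;b;z)`. -/
def oneF1 (a b z : ℂ) : ℂ :=
  ∑' k : ℕ, risingFac a k / risingFac b k * z ^ k / (Nat.factorial k : ℂ)

/-- The terminating Gauss hypergeometric sum `₂F₁(-m, c; d; x)`. -/
def twoF1t (m : ℕ) (c d x : ℂ) : ℂ :=
  ∑ k ∈ Finset.range (m + 1), (m.choose k : ℂ) * (risingFac c k / risingFac d k) * (-x) ^ k

/-- Real version of the terminating Gauss hypergeometric sum. -/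
def twoF1tR (m : ℕ) (c d x : ℝ) : ℝ :=
  ∑ k ∈ Finset.range (m + 1), (m.choose k : ℝ) * (risingFacR c k / risingFacR d k) * (-x) ^ k

/-- The polynomial reproducing kernel built from a family of polynomials. -/
def repKernel (φ : ℕ → Polynomial ℂ) (n : ℕ) (z w : ℂ) : ℂ :=
  ∑ j ∈ Finset.range (n + 1), (φ j).eval z * conj ((φ j).eval w)

/-- `φ` is the family of orthonormal polynomials of `μ`, with (positive real) leading
coefficients `κ`. -/
structure IsOrthonormalPolys (μ : Measure ℂ) (φ : ℕ → Polynomial ℂ) (κ : ℕ → ℝ) : Prop where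
  natDegree_eq : ∀ n, (φ n).natDegree = n
  lead_pos : ∀ n, 0 < κ n
  lead_eq : ∀ n, (φ n).leadingCoeff = (κ n : ℂ)
  orthonormal : ∀ m n, ∫ z, (φ m).eval z * conj ((φ n).eval z) ∂μ = if m = n then 1 else 0

/-- The (closed) support of a measure on `ℂ`. -/
def msupport (μ : Measure ℂ) : Set ℂ := {z | ∀ U : Set ℂ, IsOpen U → z ∈ U → 0 < μ U}

/-- Logarithmic capacity of a compact set, defined via the transfinite diameter. -/
def capacity (K : Set ℂ) : ℝ :=
  ⨅ n : ℕ, ⨆ f : {f : Fin (n + 2) → ℂ // ∀ i, f i ∈ K},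
    (∏ p ∈ Finset.univ.filter (fun p : Fin (n + 2) × Fin (n + 2) => p.1 < p.2),
        ‖f.1 p.1 - f.1 p.2‖) ^ (2 / (((n : ℝ) + 2) * ((n : ℝ) + 1)))

/-- Stahl–Totik regularity of a measure `μ` whose orthonormal polynomials have leading
coefficients `κ`:  `κ n ^ (1/n) → 1 / cap (supp μ)`. -/
def IsRegularST (μ : Measure ℂ) (κ : ℕ → ℝ) : Prop :=
  Tendsto (fun n : ℕ => κ n ^ ((n : ℝ)⁻¹)) atTop (𝓝 (1 / capacity (msupport μ)))

/-- The Christoffel function `λ_n(z; μ)`. -/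
def christoffel (μ : Measure ℂ) (n : ℕ) (z : ℂ) : ℝ :=
  sInf {x : ℝ | ∃ P : Polynomial ℂ, P.natDegree ≤ n ∧ P.eval z = 1 ∧
    x = ∫ w, ‖P.eval w‖ ^ 2 ∂μ}

/-- Arclength measure `dθ` on the unit circle (parametrized over `[0, 2π]`). -/
def circleArc : Measure ℂ :=
  Measure.map (fun θ : ℝ => Complex.exp (Complex.I * θ)) (volume.restrict (Icc (0:ℝ) (2 * Real.pi)))

/-- The measure `w(θ) dθ/(2π)` on the unit circle. -/
def circleAC (w : ℝ → ℝ) : Measure ℂ :=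
  Measure.map (fun θ : ℝ => Complex.exp (Complex.I * θ))
    ((volume.restrict (Icc (0:ℝ) (2 * Real.pi))).withDensity fun θ =>
      ENNReal.ofReal (w θ / (2 * Real.pi)))

/-- The Hua–Pickrell weight. -/
def hpWeight (γ τ : ℝ) (θ : ℝ) : ℝ :=
  (4:ℝ) ^ γ * ‖Complex.Gamma (1 + (γ:ℂ) + Complex.I * (τ:ℂ))‖ ^ 2
      / Real.Gamma (2 * γ + 1)
    * Real.exp ((Real.pi - θ) * τ) * Real.sin (θ / 2) ^ (2 * γ)

/-- The Hua–Pickrell measure on the unit circle. -/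
def huaPickrell (γ τ : ℝ) : Measure ℂ := circleAC (hpWeight γ τ)

/-- The limiting kernel appearing in Theorem 1.1, with the diagonal `a = b̄` interpreted
by continuity. -/
def hpLimitKernel (γ τ : ℝ) (a b : ℂ) : ℂ :=
  let y : ℂ := (γ:ℂ) + Complex.I * (τ:ℂ)
  let c : ℂ := 2 * (γ:ℂ) + 1
  if a = conj b then
    oneF1 (1 + conj y) c (-Complex.I * conj b) * oneF1 (2 + y) (c + 1) (Complex.I * conj b)
        * (1 + y)
      - oneF1 (conj y) c (-Complex.I * conj b) * oneF1 (1 + y) (c + 1) (Complex.I * conj b) * y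
  else
    c * (oneF1 (conj y) c (-Complex.I * conj b) * oneF1 y c (Complex.I * a)
        - oneF1 (1 + conj y) c (-Complex.I * conj b) * oneF1 (1 + y) c (Complex.I * a))
      / (Complex.I * (conj b - a))

/-- The lemniscate region `G_{r,m} = {z : |z^m - 1| < r^m}`. -/
def lemniscate (r : ℝ) (m : ℕ) : Set ℂ := {z : ℂ | ‖z ^ m - 1‖ < r ^ m}

/-- The function `H = ₁F₁(2;3;·)`. -/
def Hfun (t : ℂ) : ℂ := if t = 0 then 1 else 2 * (Complex.exp t * (t - 1) + 1) / t ^ 2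

/-- The function `T` of (2.1). -/
def Tfun (γ : ℝ) (a : ℝ) : ℂ :=
  oneF1 (1 + (γ:ℂ)) (2 * (γ:ℂ) + 1) (-Complex.I * (a:ℂ))
      * oneF1 (2 + (γ:ℂ)) (2 * (γ:ℂ) + 2) (Complex.I * (a:ℂ)) * (1 + (γ:ℂ))
    - oneF1 (γ:ℂ) (2 * (γ:ℂ) + 1) (-Complex.I * (a:ℂ))
      * oneF1 (1 + (γ:ℂ)) (2 * (γ:ℂ) + 2) (Complex.I * (a:ℂ)) * (γ:ℂ)

end
noncomputable section HP

def hpZ (θ : ℝ) : ℂ := Complex.exp (Complex.I * θ)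
def hpV (θ : ℝ) : ℂ := Complex.exp (-(Complex.I * θ))
def hpW (γ τ θ : ℝ) : ℝ := Real.exp ((Real.pi - θ) * τ) * Real.sin (θ / 2) ^ (2 * γ)
def hpU (γ τ : ℝ) (j k : ℕ) : ℂ :=
  ∫ θ in (0:ℝ)..(2 * Real.pi), (1 - hpZ θ) ^ j * (1 - hpV θ) ^ k * (hpW γ τ θ : ℂ)

lemma hpZV (θ : ℝ) : hpZ θ * hpV θ = 1 := by
  rw [hpZ, hpV, ← Complex.exp_add]; simp

lemma hpZ_conj (θ : ℝ) : conj (hpZ θ) = hpV θ := by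
  rw [hpZ, hpV, ← Complex.exp_conj]; simp

lemma hpV_conj (θ : ℝ) : conj (hpV θ) = hpZ θ := by
  rw [← hpZ_conj, Complex.conj_conj]

lemma hpZ_cont : Continuous hpZ := by unfold hpZ; fun_prop
lemma hpV_cont : Continuous hpV := by unfold hpV; fun_prop

lemma hpZ_deriv (θ : ℝ) : HasDerivAt hpZ (Complex.I * hpZ θ) θ := by
  have h := (((hasDerivAt_id (θ:ℂ)).const_mul Complex.I).cexp).comp_ofReal
  refine h.congr_deriv ?_
  simp [hpZ, mul_comm]

lemma hpV_deriv (θ : ℝ) : HasDerivAt hpV (-Complex.I * hpV θ) θ := by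
  have h := (((hasDerivAt_id (θ:ℂ)).const_mul Complex.I).neg.cexp).comp_ofReal
  refine h.congr_deriv ?_
  simp [hpV, mul_comm]

lemma hp_sin_pos {θ : ℝ} (h : θ ∈ Ioo 0 (2 * Real.pi)) : 0 < Real.sin (θ / 2) := by
  apply Real.sin_pos_of_pos_of_lt_pi
  · linarith [h.1]
  · linarith [h.2]

lemma hp_sin_nonneg {θ : ℝ} (h : θ ∈ Icc 0 (2 * Real.pi)) : 0 ≤ Real.sin (θ / 2) := by
  apply Real.sin_nonneg_of_nonneg_of_le_pi
  · linarith [h.1]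
  · linarith [h.2]

lemma hpZ_half (θ : ℝ) :
    hpZ θ = (Complex.cos (θ / 2) + Complex.sin (θ / 2) * Complex.I) ^ 2 := by
  rw [← Complex.exp_mul_I, ← Complex.exp_nat_mul, hpZ]
  congr 1
  push_cast; ring

lemma hpZ_sub (θ : ℝ) : 1 - hpZ θ =
    -2 * Complex.I * (Complex.cos (θ / 2) + Complex.sin (θ / 2) * Complex.I) * Complex.sin (θ / 2) := by
  rw [hpZ_half]
  have := Complex.sin_sq_add_cos_sq ((θ:ℂ) / 2)
  linear_combination (-1) * this + (Complex.sin (θ / 2))^2 * (2 - 1) * Complex.I_sq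

lemma hpZ_add (θ : ℝ) : 1 + hpZ θ =
    2 * (Complex.cos (θ / 2) + Complex.sin (θ / 2) * Complex.I) * Complex.cos (θ / 2) := by
  rw [hpZ_half]
  have := Complex.sin_sq_add_cos_sq ((θ:ℂ) / 2)
  linear_combination (-1) * this + (Complex.sin (θ / 2))^2 * Complex.I_sq

/-- `(1-z) cos(θ/2) = -i (1+z) sin(θ/2)` -/
lemma hpZ_cot (θ : ℝ) : (1 - hpZ θ) * Complex.cos (θ / 2) =
    -Complex.I * (1 + hpZ θ) * Complex.sin (θ / 2) := by
  rw [hpZ_sub, hpZ_add]; ring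

lemma hp_sin_integrable {e : ℝ} (he : -1 < e) :
    IntervalIntegrable (fun θ : ℝ => Real.sin (θ / 2) ^ e) volume 0 (2 * Real.pi) := by
  have hpi := Real.pi_pos
  rcases le_or_gt 0 e with h | h
  · apply Continuous.intervalIntegrable
    exact (Real.continuous_sin.comp (continuous_id.div_const 2)).rpow_const (fun x => Or.inr h)
  · have h1 : IntervalIntegrable (fun θ : ℝ => θ ^ e) volume 0 (2 * Real.pi) :=
      intervalIntegral.intervalIntegrable_rpow' he
    have h2 : IntervalIntegrable (fun θ : ℝ => (2 * Real.pi - θ) ^ e) volume 0 (2 * Real.pi) := by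
      have := (h1.comp_sub_left (2 * Real.pi)).symm
      simpa using this
    have h3 := (h1.add h2).const_mul ((1 / Real.pi) ^ e)
    refine IntervalIntegrable.mono_fun' h3 ?_ ?_
    · apply Measurable.aestronglyMeasurable
      fun_prop
    · rw [uIoc_of_le (by positivity), ← restrict_Ioo_eq_restrict_Ioc]
      refine (ae_restrict_iff' measurableSet_Ioo).2 (Eventually.of_forall fun θ hθ => ?_)
      have hs := hp_sin_pos hθ
      have h0 := hθ.1
      have h2p := hθ.2
      beta_reduce
      rw [Real.norm_of_nonneg (Real.rpow_nonneg hs.le _)]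
      have a1 : 0 ≤ θ ^ e := Real.rpow_nonneg h0.le _
      have a2 : 0 ≤ (2 * Real.pi - θ) ^ e := Real.rpow_nonneg (by linarith) _
      have a3 : 0 ≤ (1 / Real.pi) ^ e := by positivity
      rcases le_or_gt θ Real.pi with hl | hl
      · have : (1 / Real.pi) * θ ≤ Real.sin (θ / 2) := by
          have := Real.mul_le_sin (x := θ / 2) (by linarith) (by linarith)
          calc _ = 2 / Real.pi * (θ / 2) := by ring
            _ ≤ _ := this
        calc Real.sin (θ / 2) ^ e ≤ ((1 / Real.pi) * θ) ^ e :=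
              Real.rpow_le_rpow_of_nonpos (by positivity) this h.le
          _ = (1 / Real.pi) ^ e * θ ^ e := Real.mul_rpow (by positivity) h0.le
          _ ≤ _ := by rw [mul_add]; nlinarith [mul_nonneg a3 a2]
      · have h4 : 0 < 2 * Real.pi - θ := by linarith
        have : (1 / Real.pi) * (2 * Real.pi - θ) ≤ Real.sin (θ / 2) := by
          have := Real.mul_le_sin (x := Real.pi - θ / 2) (by linarith) (by linarith)
          rw [Real.sin_pi_sub] at this
          calc _ = 2 / Real.pi * (Real.pi - θ / 2) := by ring
            _ ≤ _ := this
        calc Real.sin (θ / 2) ^ e ≤ ((1 / Real.pi) * (2 * Real.pi - θ)) ^ e :=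
              Real.rpow_le_rpow_of_nonpos (by positivity) this h.le
          _ = (1 / Real.pi) ^ e * (2 * Real.pi - θ) ^ e := Real.mul_rpow (by positivity) h4.le
          _ ≤ _ := by rw [mul_add]; nlinarith [mul_nonneg a3 a1]

lemma hpW_integrable {γ τ : ℝ} (hγ : -(1/2) < γ) :
    IntervalIntegrable (hpW γ τ) volume 0 (2 * Real.pi) := by
  unfold hpW
  apply IntervalIntegrable.continuousOn_mul (hp_sin_integrable (by linarith))
  fun_prop

lemma hpWc_integrable {γ τ : ℝ} (hγ : -(1/2) < γ) {f : ℝ → ℂ} (hf : Continuous f) :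
    IntervalIntegrable (fun θ => f θ * (hpW γ τ θ : ℂ)) volume 0 (2 * Real.pi) := by
  apply IntervalIntegrable.continuousOn_mul _ hf.continuousOn
  exact ⟨(hpW_integrable hγ).1.ofReal, (hpW_integrable hγ).2.ofReal⟩

lemma hpW_deriv (γ τ : ℝ) {θ : ℝ} (h : θ ∈ Ioo 0 (2 * Real.pi)) :
    HasDerivAt (hpW γ τ)
      ((-τ + γ * (Real.cos (θ / 2) / Real.sin (θ / 2))) * hpW γ τ θ) θ := by
  have hs := hp_sin_pos h
  have h1 : HasDerivAt (fun θ : ℝ => Real.exp ((Real.pi - θ) * τ))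
      (Real.exp ((Real.pi - θ) * τ) * (-1 * τ)) θ :=
    (((hasDerivAt_id θ).const_sub Real.pi).mul_const τ).exp
  have h2 : HasDerivAt (fun θ : ℝ => Real.sin (θ / 2)) (Real.cos (θ / 2) * (1 / 2)) θ :=
    ((hasDerivAt_id θ).div_const 2).sin
  have h3 := h2.rpow_const (p := 2 * γ) (Or.inl hs.ne')
  have h4 := h1.mul h3
  refine h4.congr_deriv ?_
  unfold hpW
  rw [Real.rpow_sub_one hs.ne']
  field_simp

lemma hpU_rec {γ τ : ℝ} (hγ : -(1/2) < γ) (j k : ℕ) :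
    ((γ:ℂ) + Complex.I * τ + j + 1) * hpU γ τ (j + 1) k = (2 * γ + 1 + j + k) * hpU γ τ j k := by
  have hpi := Real.pi_pos
  let g : ℝ → ℂ := fun θ => (1 - hpZ θ) ^ (j + 1) * (1 - hpV θ) ^ k * (hpW γ τ θ : ℂ)
  let g' : ℝ → ℂ := fun θ =>
    (-Complex.I * (2 * γ + 1 + j + k)) * ((1 - hpZ θ) ^ j * (1 - hpV θ) ^ k * (hpW γ τ θ : ℂ)) +
    (Complex.I * ((γ:ℂ) + Complex.I * τ + j + 1)) *
      ((1 - hpZ θ) ^ (j + 1) * (1 - hpV θ) ^ k * (hpW γ τ θ : ℂ))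
  have hZ := hpZ_cont
  have hV := hpV_cont
  have I1 : IntervalIntegrable (fun θ => (1 - hpZ θ) ^ j * (1 - hpV θ) ^ k * (hpW γ τ θ : ℂ))
      volume 0 (2 * Real.pi) := hpWc_integrable hγ (by fun_prop)
  have I2 : IntervalIntegrable (fun θ => (1 - hpZ θ) ^ (j+1) * (1 - hpV θ) ^ k * (hpW γ τ θ : ℂ))
      volume 0 (2 * Real.pi) := hpWc_integrable hγ (by fun_prop)
  have hd : ∀ θ ∈ Ioo 0 (2 * Real.pi), HasDerivAt g (g' θ) θ := by
    intro θ hθ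
    have hs := hp_sin_pos hθ
    have d1 := ((hpZ_deriv θ).const_sub 1).pow (j + 1)
    have d2 := ((hpV_deriv θ).const_sub 1).pow k
    have d3 := (hpW_deriv γ τ hθ).ofReal_comp
    have d := (d1.mul d2).mul d3
    refine d.congr_deriv ?_
    have hsc : Complex.sin (θ / 2) ≠ 0 := by
      have : ((Real.sin (θ / 2) : ℝ) : ℂ) ≠ 0 := by exact_mod_cast hs.ne'
      simpa using this
    have hcot : (1 - hpZ θ) * (Complex.cos (θ / 2) / Complex.sin (θ / 2)) =
      -Complex.I * (1 + hpZ θ) := by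
      rw [mul_div_assoc', hpZ_cot]; field_simp
    have hk : (k:ℂ) * (1 - hpV θ) ^ (k - 1) * (-(-Complex.I * hpV θ)) * (1 - hpZ θ)
        = - Complex.I * k * (1 - hpV θ) ^ k := by
      rcases k with _ | k
      · simp
      · have := hpZV θ
        simp only [Nat.add_sub_cancel]
        rw [pow_succ]
        linear_combination (-Complex.I * ((k + 1 : ℕ):ℂ) * (1 - hpV θ) ^ k) * this
    simp only [g', Pi.mul_apply, Pi.pow_apply, Nat.add_sub_cancel]
    push_cast
    linear_combination (1 - hpZ θ) ^ j * (1 - hpV θ) ^ k * (hpW γ τ θ : ℂ) * γ * hcot +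
      (1 - hpZ θ) ^ j * (hpW γ τ θ : ℂ) * hk 
      - (1 - hpZ θ) ^ (j+1) * (1 - hpV θ) ^ k * (hpW γ τ θ : ℂ) * τ * Complex.I_sq
  have hc : ContinuousOn g (Icc 0 (2 * Real.pi)) := by
    have : ContinuousOn (fun θ : ℝ => (1 - hpZ θ) ^ j * (1 - hpV θ) ^ k *
        (-2 * Complex.I * (Complex.cos (θ / 2) + Complex.sin (θ / 2) * Complex.I)) *
        ((Real.exp ((Real.pi - θ) * τ) * Real.sin (θ / 2) ^ (2 * γ + 1) : ℝ) : ℂ))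
        (Icc 0 (2 * Real.pi)) := by
      apply Continuous.continuousOn
      have : Continuous fun θ : ℝ => Real.sin (θ / 2) ^ (2 * γ + 1) :=
        (Real.continuous_sin.comp (continuous_id.div_const 2)).rpow_const
          (fun x => Or.inr (by linarith))
      fun_prop
    refine this.congr fun θ hθ => ?_
    have hs := hp_sin_nonneg hθ
    have : Real.sin (θ / 2) * Real.sin (θ / 2) ^ (2 * γ) = Real.sin (θ / 2) ^ (2 * γ + 1) := by
      rcases hs.eq_or_lt with h | h
      · rw [← h, Real.zero_rpow (by linarith : 2 * γ + 1 ≠ 0)]; simp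
      · rw [Real.rpow_add_one h.ne', mul_comm]
    simp only [g, hpW]
    rw [← this, pow_succ]
    nth_rewrite 2 [hpZ_sub]
    push_cast
    ring
  have key := intervalIntegral.integral_eq_sub_of_hasDerivAt_of_le (by positivity) hc hd
    ((I1.const_mul _).add (I2.const_mul _))
  have hg0 : g 0 = 0 := by simp [g, hpZ]
  have hg1 : g (2 * Real.pi) = 0 := by
    have : hpZ (2 * Real.pi) = 1 := by
      rw [hpZ]; push_cast; rw [mul_comm]; exact Complex.exp_two_pi_mul_I
    simp [g, this]
  rw [hg0, hg1, sub_zero] at key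
  simp only [g'] at key
  rw [intervalIntegral.integral_add (I1.const_mul _) (I2.const_mul _),
    intervalIntegral.integral_const_mul, intervalIntegral.integral_const_mul] at key
  change _ * hpU γ τ j k + _ * hpU γ τ (j+1) k = 0 at key
  have := mul_eq_zero.1 (show Complex.I * (((γ:ℂ) + Complex.I * τ + j + 1) * hpU γ τ (j + 1) k - (2 * γ + 1 + j + k) * hpU γ τ j k) = 0 by linear_combination key)
  rcases this with h | h
  · simp at h
  · exact sub_eq_zero.1 h

lemma hpU_conj (γ τ : ℝ) (j k : ℕ) : conj (hpU γ τ j k) = hpU γ τ k j := by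
  unfold hpU
  have hpi := Real.pi_pos
  rw [intervalIntegral.integral_of_le (by positivity), intervalIntegral.integral_of_le (by positivity),
    ← integral_conj]
  congr 1
  ext θ
  simp only [map_mul, map_pow, map_sub, map_one, hpZ_conj, hpV_conj, Complex.conj_ofReal]
  ring

lemma hpU_rec' {γ τ : ℝ} (hγ : -(1/2) < γ) (j k : ℕ) :
    ((γ:ℂ) - Complex.I * τ + k + 1) * hpU γ τ j (k + 1) = (2 * γ + 1 + j + k) * hpU γ τ j k := by
  have := congrArg conj (hpU_rec (τ := τ) hγ k j)
  simp only [map_mul, hpU_conj, map_add, Complex.conj_ofReal, Complex.conj_I, map_natCast, map_one,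
    map_ofNat] at this
  linear_combination this

lemma hpU_shift (γ τ : ℝ) : hpU γ τ 1 1 = 4 * hpU (γ + 1) τ 0 0 := by
  have hpi := Real.pi_pos
  unfold hpU
  rw [← intervalIntegral.integral_const_mul]
  apply intervalIntegral.integral_congr_ae
  rw [uIoc_of_le (by positivity), ← ae_restrict_iff' measurableSet_Ioc,
    ← restrict_Ioo_eq_restrict_Ioc]
  refine (ae_restrict_iff' measurableSet_Ioo).2 (Eventually.of_forall fun θ hθ => ?_)
  have hs := hp_sin_pos hθ
  have h1 : (1 - hpZ θ) * (1 - hpV θ) = 4 * Complex.sin (θ / 2) ^ 2 := by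
    have h2 := congrArg conj (hpZ_sub θ)
    have h3 : (conj (Complex.cos (θ / 2)) : ℂ) = Complex.cos (θ / 2) := by
      rw [show (θ:ℂ) / 2 = ((θ / 2 : ℝ) : ℂ) by push_cast; rfl, ← Complex.ofReal_cos, Complex.conj_ofReal]
    have h4 : (conj (Complex.sin (θ / 2)) : ℂ) = Complex.sin (θ / 2) := by
      rw [show (θ:ℂ) / 2 = ((θ / 2 : ℝ) : ℂ) by push_cast; rfl, ← Complex.ofReal_sin, Complex.conj_ofReal]
    simp only [map_mul, map_add, map_sub, map_one, hpZ_conj, h3, h4, Complex.conj_I, map_neg,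
      map_ofNat] at h2
    rw [h2, hpZ_sub]
    have := Complex.sin_sq_add_cos_sq ((θ:ℂ) / 2)
    have hI := Complex.I_sq
    have hI4 : Complex.I ^ 4 = 1 := by simp
    linear_combination (4 * Complex.sin (θ / 2) ^ 2) * this
      + (-4 * Complex.sin (θ / 2) ^ 2 * Complex.cos (θ / 2) ^ 2) * hI +
       (4 * Complex.sin (θ / 2) ^ 4) * hI4
  have h5 : hpW (γ + 1) τ θ = hpW γ τ θ * Real.sin (θ / 2) ^ 2 := by
    unfold hpW
    rw [show 2 * (γ + 1) = 2 * γ + 2 by ring, Real.rpow_add hs, Real.rpow_two]; ring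
  simp only [pow_one, pow_zero, one_mul]
  rw [h1, h5]
  push_cast
  ring


def hpI (γ τ : ℝ) : ℝ := ∫ θ in (0:ℝ)..(2 * Real.pi), hpW γ τ θ
def hpR (γ τ : ℝ) : ℝ :=
  (4:ℝ) ^ γ * ‖Complex.Gamma (1 + (γ:ℂ) + Complex.I * (τ:ℂ))‖ ^ 2 / Real.Gamma (2 * γ + 1)

lemma hpU_zero (γ τ : ℝ) : hpU γ τ 0 0 = (hpI γ τ : ℂ) := by
  simp [hpU, hpI, intervalIntegral.integral_ofReal]

lemma hpI_rec {γ τ : ℝ} (hγ : -(1/2) < γ) :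
    ‖1 + (γ:ℂ) + Complex.I * (τ:ℂ)‖ ^ 2 * (4 * hpI (γ + 1) τ)
      = (2 * γ + 1 + 1) * ((2 * γ + 1) * hpI γ τ) := by
  have h1 := hpU_rec (τ := τ) hγ 0 0
  have h2 := hpU_rec' (τ := τ) hγ 1 0
  have h3 := hpU_shift γ τ
  rw [hpU_zero] at h1 h3
  simp only [zero_add, h3] at h1 h2
  push_cast at h1 h2
  have h4 : ((‖1 + (γ:ℂ) + Complex.I * (τ:ℂ)‖ ^ 2 : ℝ) : ℂ) =
      (1 + (γ:ℂ) + Complex.I * (τ:ℂ)) * (1 + (γ:ℂ) - Complex.I * (τ:ℂ)) := by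
    rw [Complex.ofReal_pow, ← Complex.mul_conj']
    simp only [map_add, map_mul, map_one, Complex.conj_ofReal, Complex.conj_I]
    ring
  have : (((‖1 + (γ:ℂ) + Complex.I * (τ:ℂ)‖ ^ 2 * (4 * hpI (γ + 1) τ) : ℝ)) : ℂ)
      = (((2 * γ + 1 + 1) * ((2 * γ + 1) * hpI γ τ) : ℝ) : ℂ) := by
    rw [Complex.ofReal_mul, h4]
    push_cast
    linear_combination ((γ:ℂ) + Complex.I * τ + 1) * h2 + (2 * γ + 1 + 1) * h1
  exact_mod_cast this

lemma hpb_ne {γ τ : ℝ} (hγ : -(1/2) < γ) : 1 + (γ:ℂ) + Complex.I * (τ:ℂ) ≠ 0 := by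
  intro h
  have := congrArg Complex.re h
  simp at this
  linarith

lemma hpR_rec {γ τ : ℝ} (hγ : -(1/2) < γ) :
    hpR (γ + 1) τ * ((2 * γ + 1 + 1) * (2 * γ + 1)) =
      4 * ‖1 + (γ:ℂ) + Complex.I * (τ:ℂ)‖ ^ 2 * hpR γ τ := by
  unfold hpR
  have e1 : (1 + ((γ + 1 : ℝ):ℂ) + Complex.I * (τ:ℂ)) = (1 + (γ:ℂ) + Complex.I * (τ:ℂ)) + 1 := by
    push_cast; ring
  rw [e1, Complex.Gamma_add_one _ (hpb_ne hγ), norm_mul,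
    show 2 * (γ + 1) + 1 = (2 * γ + 1 + 1) + 1 by ring, Real.Gamma_add_one (by linarith),
    Real.Gamma_add_one (by linarith), Real.rpow_add_one (by norm_num)]
  have : Real.Gamma (2 * γ + 1) ≠ 0 := (Real.Gamma_pos_of_pos (by linarith)).ne'
  have h1 : 2 * γ + 1 ≠ 0 := by linarith
  have h2 : 2 * γ + 1 + 1 ≠ 0 := by linarith
  field_simp

lemma hpG_rec {γ τ : ℝ} (hγ : -(1/2) < γ) :
    hpR (γ + 1) τ * hpI (γ + 1) τ = hpR γ τ * hpI γ τ := by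
  have h1 := hpR_rec (τ := τ) hγ
  have h2 := hpI_rec (τ := τ) hγ
  have h3 : (2 * γ + 1 + 1) * (2 * γ + 1) ≠ 0 := mul_ne_zero (by linarith) (by linarith)
  apply mul_left_cancel₀ h3
  linear_combination hpI (γ + 1) τ * h1 + hpR γ τ * h2

lemma hpG_nat {γ τ : ℝ} (hγ : -(1/2) < γ) (k : ℕ) :
    hpR (γ + k) τ * hpI (γ + k) τ = hpR γ τ * hpI γ τ := by
  induction k with
  | zero => simp
  | succ k ih =>
    rw [← ih, ← hpG_rec (γ := γ + k) (by have : (0:ℝ) ≤ k := k.cast_nonneg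
                                         linarith)]
    push_cast
    rw [add_assoc]

lemma hpG_zero (τ : ℝ) : hpR 0 τ * hpI 0 τ = 2 * Real.pi := by
  rcases eq_or_ne τ 0 with rfl | hτ
  · simp [hpR, hpI, hpW]
  have hI : hpI 0 τ = (Real.exp (Real.pi * τ) - Real.exp (-(Real.pi * τ))) / τ := by
    have hd : ∀ θ ∈ uIcc 0 (2 * Real.pi), HasDerivAt (fun θ : ℝ => Real.exp ((Real.pi - θ) * τ) / (-τ))
      (hpW 0 τ θ) θ := by
      intro θ _
      have h1 : HasDerivAt (fun θ : ℝ => Real.exp ((Real.pi - θ) * τ))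
        (Real.exp ((Real.pi - θ) * τ) * (-1 * τ)) θ :=
        (((hasDerivAt_id θ).const_sub Real.pi).mul_const τ).exp
      refine (h1.div_const (-τ)).congr_deriv ?_
      simp [hpW]
      field_simp
    rw [hpI, intervalIntegral.integral_eq_sub_of_hasDerivAt hd (hpW_integrable (by norm_num))]
    rw [show (Real.pi - 2 * Real.pi) * τ = -(Real.pi * τ) by ring, sub_zero]
    field_simp
    ring
  have hne : Complex.I * (τ:ℂ) ≠ 0 := by simp [hτ]
  have hsh : Real.sinh (Real.pi * τ) ≠ 0 := by
    rw [Ne, Real.sinh_eq_zero]; exact mul_ne_zero Real.pi_ne_zero hτ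
  have hR : ‖Complex.Gamma (1 + Complex.I * (τ:ℂ))‖ ^ 2 = Real.pi * τ / Real.sinh (Real.pi * τ) := by
    have : ((‖Complex.Gamma (1 + Complex.I * (τ:ℂ))‖ ^ 2 : ℝ) : ℂ) =
      ((Real.pi * τ / Real.sinh (Real.pi * τ) : ℝ) : ℂ) := by
      rw [Complex.ofReal_pow, ← Complex.mul_conj', ← Complex.Gamma_conj]
      have e : conj (1 + Complex.I * (τ:ℂ)) = 1 - Complex.I * τ := by
        simp [Complex.conj_ofReal]; ring
      rw [e, add_comm 1, Complex.Gamma_add_one _ hne, mul_assoc, Complex.Gamma_mul_Gamma_one_sub]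
      rw [show (Real.pi:ℂ) * (Complex.I * τ) = (Real.pi * τ) * Complex.I by ring, Complex.sin_mul_I]
      push_cast
      have : Complex.sinh (Real.pi * τ) ≠ 0 := by exact_mod_cast hsh
      have := Complex.I_ne_zero
      field_simp
    exact_mod_cast this
  rw [hI, hpR]
  simp only [Complex.ofReal_zero, add_zero, mul_zero, zero_add, Real.Gamma_one, Real.rpow_zero]
  rw [hR]
  rw [Real.sinh_eq] at hsh ⊢
  have h2 : Real.exp (Real.pi * τ) - Real.exp (-(Real.pi * τ)) ≠ 0 := by
    intro h; rw [h] at hsh; simp at hsh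
  field_simp

lemma hpI_anti {γ γ' τ : ℝ} (hγ : -(1/2) < γ) (h : γ ≤ γ') : hpI γ' τ ≤ hpI γ τ := by
  have hpi := Real.pi_pos
  apply intervalIntegral.integral_mono_on_of_le_Ioo (by positivity)
    (hpW_integrable (by linarith)) (hpW_integrable hγ)
  intro θ hθ
  have hs := hp_sin_pos hθ
  unfold hpW
  have := Real.rpow_le_rpow_of_exponent_ge hs (Real.sin_le_one _) (show 2 * γ ≤ 2 * γ' by linarith)
  gcongr

lemma Gamma_asymp {s : ℂ} (hs : 0 < s.re) :
    Tendsto (fun k : ℕ => ‖Complex.Gamma (s + k + 1)‖ / ((k:ℝ) ^ s.re * k.factorial)) atTop (𝓝 1) := by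
  have h0 : Complex.Gamma s ≠ 0 := Complex.Gamma_ne_zero_of_re_pos hs
  have h1 := (Complex.GammaSeq_tendsto_Gamma s).norm
  have h2 := (tendsto_const_nhds (x := ‖Complex.Gamma s‖)).div h1 (norm_ne_zero_iff.2 h0)
  rw [div_self (norm_ne_zero_iff.2 h0)] at h2
  refine h2.congr' ?_
  filter_upwards [eventually_gt_atTop 0] with k hk
  have hk' : (0:ℝ) < k := by exact_mod_cast hk
  have hG : ∀ k : ℕ, Complex.Gamma (s + k + 1)
      = (∏ j ∈ Finset.range (k + 1), (s + (j:ℂ))) * Complex.Gamma s := by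
    intro k
    induction k with
    | zero =>
      simp [Complex.Gamma_add_one s (by rintro rfl; simp at hs)]
    | succ k ih =>
      rw [Finset.prod_range_succ, Complex.Gamma_add_one]
      · push_cast
        rw [← add_assoc, ih]; ring
      · intro h
        have := congrArg Complex.re h
        simp at this
        have : (0:ℝ) ≤ k := k.cast_nonneg
        linarith
  change ‖Complex.Gamma s‖ / ‖(k:ℂ) ^ s * k.factorial / ∏ j ∈ Finset.range (k + 1), (s + (j:ℂ))‖ = _
  rw [hG, norm_mul, norm_div, norm_mul, Complex.norm_natCast_cpow_of_pos hk,
    Complex.norm_natCast]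
  field_simp

lemma Gamma_asympR {s : ℝ} (hs : 0 < s) :
    Tendsto (fun k : ℕ => Real.Gamma (s + k + 1) / ((k:ℝ) ^ s * k.factorial)) atTop (𝓝 1) := by
  have := Gamma_asymp (s := (s:ℂ)) (by simpa using hs)
  refine this.congr fun k => ?_
  rw [show (s:ℂ) + k + 1 = ((s + k + 1 : ℝ) : ℂ) by push_cast; ring, Complex.Gamma_ofReal,
    Complex.norm_real, Real.norm_of_nonneg, Complex.ofReal_re]
  exact (Real.Gamma_pos_of_pos (by positivity)).le

lemma hpR_eq {γ τ : ℝ} (hγ : -(1/2) < γ) :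
    hpR γ τ = ‖Complex.Gamma (1 + (γ:ℂ) + Complex.I * (τ:ℂ))‖ ^ 2 * √Real.pi /
      (Real.Gamma (γ + 1/2) * Real.Gamma (γ + 1)) := by
  have h := Real.Gamma_mul_Gamma_add_half (γ + 1/2)
  rw [show γ + 1/2 + 1/2 = γ + 1 by ring, show 2 * (γ + 1/2) = 2 * γ + 1 by ring,
    show 1 - (2 * γ + 1) = -(2 * γ) by ring, Real.rpow_neg (by norm_num),
    Real.rpow_mul (by norm_num)] at h
  rw [h, hpR]
  have h1 : Real.Gamma (2 * γ + 1) ≠ 0 := (Real.Gamma_pos_of_pos (by linarith)).ne'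
  norm_num
  field_simp

lemma hpR_asymp {γ : ℝ} (τ : ℝ) (hγ : 1 ≤ γ) :
    Tendsto (fun k : ℕ => hpR (γ + k) τ / √k) atTop (𝓝 (√Real.pi)) := by
  have h1 := Gamma_asymp (s := (γ:ℂ) + Complex.I * τ) (by simp; linarith)
  have h2 := Gamma_asympR (s := γ - 1/2) (by linarith)
  have h3 := Gamma_asympR (s := γ) (by linarith)
  have h4 := ((h1.pow 2).mul_const (√Real.pi)).div (h2.mul h3) (by norm_num)
  simp only [one_pow, one_mul, div_one] at h4
  refine h4.congr' ?_
  filter_upwards [eventually_gt_atTop 0] with k hk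
  have hk' : (0:ℝ) < k := by exact_mod_cast hk
  simp only [Pi.div_apply]
  rw [hpR_eq (by linarith)]
  have e1 : (γ:ℂ) + Complex.I * τ + k + 1 = 1 + ((γ + k : ℝ):ℂ) + Complex.I * τ := by
    push_cast; ring
  have e2 : γ - 1/2 + k + 1 = γ + k + 1/2 := by ring
  have e3 : ((γ:ℂ) + Complex.I * τ).re = γ := by simp
  rw [e1, e2, e3, Real.rpow_sub hk', ← Real.sqrt_eq_rpow]
  have g1 : 0 < Real.Gamma (γ + k + 1/2) := Real.Gamma_pos_of_pos (by linarith)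
  have g2 : 0 < Real.Gamma (γ + k + 1) := Real.Gamma_pos_of_pos (by linarith)
  have g3 : 0 < √(k:ℝ) := Real.sqrt_pos.2 hk'
  have g4 : (0:ℝ) < k.factorial := by exact_mod_cast k.factorial_pos
  have g5 : (0:ℝ) < (k:ℝ) ^ γ := by positivity
  field_simp

lemma hpR_pos {γ : ℝ} (τ : ℝ) (hγ : -(1/2) < γ) : 0 < hpR γ τ := by
  unfold hpR
  have : 0 < Real.Gamma (2 * γ + 1) := Real.Gamma_pos_of_pos (by linarith)
  have : Complex.Gamma (1 + (γ:ℂ) + Complex.I * (τ:ℂ)) ≠ 0 :=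
    Complex.Gamma_ne_zero_of_re_pos (by simp; linarith)
  have := norm_pos_iff.2 this
  positivity

lemma hpR_ratio {γ γ' : ℝ} (τ : ℝ) (hγ : 1 ≤ γ) (hγ' : 1 ≤ γ') :
    Tendsto (fun k : ℕ => hpR (γ + k) τ / hpR (γ' + k) τ * (2 * Real.pi)) atTop
      (𝓝 (2 * Real.pi)) := by
  have hp : √Real.pi ≠ 0 := (Real.sqrt_pos.2 Real.pi_pos).ne'
  have h := ((hpR_asymp τ hγ).div (hpR_asymp τ hγ') hp).mul_const (2 * Real.pi)
  rw [div_self hp, one_mul] at h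
  refine h.congr' ?_
  filter_upwards [eventually_gt_atTop 0] with k hk
  have hk' : (0:ℝ) < k := by exact_mod_cast hk
  have g3 : 0 < √(k:ℝ) := Real.sqrt_pos.2 hk'
  have := hpR_pos (γ := γ' + k) τ (by linarith)
  simp only [Pi.div_apply]
  field_simp

lemma hpG_int (τ : ℝ) (m : ℕ) : hpR m τ * hpI m τ = 2 * Real.pi := by
  have := hpG_nat (γ := 0) (τ := τ) (by norm_num) m
  rw [zero_add] at this
  rw [this, hpG_zero]

lemma hpG_one {γ : ℝ} (τ : ℝ) (hγ : 1 ≤ γ) : hpR γ τ * hpI γ τ = 2 * Real.pi := by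
  have hm : 1 ≤ ⌊γ⌋₊ := Nat.one_le_floor_iff γ |>.2 hγ
  have hm' : (1:ℝ) ≤ (⌊γ⌋₊ : ℝ) := by exact_mod_cast hm
  have hl : (⌊γ⌋₊ : ℝ) ≤ γ := Nat.floor_le (by linarith)
  have hu : γ < (⌊γ⌋₊ : ℝ) + 1 := Nat.lt_floor_add_one γ
  have ef : ∀ (m k : ℕ), 1 ≤ m → hpI ((m:ℝ) + k) τ = 2 * Real.pi / hpR ((m:ℝ) + k) τ := by
    intro m k hm
    have := hpG_int τ (m + k)
    push_cast at this
    have hp := hpR_pos (γ := (m:ℝ) + k) τ (lt_of_lt_of_le (by norm_num) (add_nonneg m.cast_nonneg k.cast_nonneg))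
    field_simp
    linarith
  apply le_antisymm
  · apply ge_of_tendsto (hpR_ratio τ hγ hm')
    filter_upwards with k
    have hk : (0:ℝ) ≤ k := k.cast_nonneg
    rw [← hpG_nat (by linarith) k]
    have := hpI_anti (τ := τ) (γ := (⌊γ⌋₊:ℝ) + k) (γ' := γ + k) (by linarith) (by linarith)
    rw [ef _ _ hm] at this
    have hp := hpR_pos (γ := γ + k) τ (by linarith)
    calc _ ≤ _ := mul_le_mul_of_nonneg_left this hp.le
      _ = _ := by ring
  · apply le_of_tendsto (hpR_ratio (γ' := ((⌊γ⌋₊ + 1 : ℕ) : ℝ)) τ hγ (by push_cast; linarith))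
    filter_upwards with k
    have hk : (0:ℝ) ≤ k := k.cast_nonneg
    rw [← hpG_nat (by linarith) k]
    have := hpI_anti (τ := τ) (γ := γ + k) (γ' := ((⌊γ⌋₊ + 1 : ℕ) : ℝ) + k) (by linarith)
      (by push_cast; linarith)
    rw [ef _ _ (by omega)] at this
    have hp := hpR_pos (γ := γ + k) τ (by linarith)
    calc _ = _ := by ring
      _ ≤ _ := mul_le_mul_of_nonneg_left this hp.le

lemma hpG {γ : ℝ} (τ : ℝ) (hγ : -(1/2) < γ) : hpR γ τ * hpI γ τ = 2 * Real.pi := by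
  rw [← hpG_nat hγ 2]
  apply hpG_one
  push_cast; linarith

lemma hpZ_meas : Measurable hpZ := hpZ_cont.measurable

lemma hpWeight_eq (γ τ θ : ℝ) : hpWeight γ τ θ = hpR γ τ * hpW γ τ θ := by
  unfold hpWeight hpR hpW; ring

lemma hpW_meas (γ τ : ℝ) : Measurable (hpW γ τ) := by unfold hpW; fun_prop

lemma hpWeight_meas (γ τ : ℝ) :
    Measurable (fun θ => ENNReal.ofReal (hpWeight γ τ θ / (2 * Real.pi))) := by
  have := hpW_meas γ τ
  simp only [hpWeight_eq]
  fun_prop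

lemma hp_dens {γ : ℝ} (τ : ℝ) (hγ : -(1/2) < γ) (f : ℝ → ℂ) :
    (fun θ => (ENNReal.ofReal (hpWeight γ τ θ / (2 * Real.pi))).toReal • f θ) =ᵐ[volume.restrict (Icc (0:ℝ) (2 * Real.pi))]
    (fun θ => ((hpR γ τ / (2 * Real.pi) : ℝ) : ℂ) * (f θ * (hpW γ τ θ : ℂ))) := by
  refine (ae_restrict_iff' measurableSet_Icc).2 (Eventually.of_forall fun θ hθ => ?_)
  have h1 : 0 ≤ hpW γ τ θ := by
    have := hp_sin_nonneg hθ
    unfold hpW; positivity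
  have h2 := (hpR_pos τ hγ).le
  have hpi := Real.pi_pos
  beta_reduce
  rw [hpWeight_eq, ENNReal.toReal_ofReal (by positivity), Complex.real_smul]
  push_cast
  ring

lemma hp_integral {γ : ℝ} (τ : ℝ) (hγ : -(1/2) < γ) {F : ℂ → ℂ} (hF : Continuous F) :
    ∫ z, F z ∂(huaPickrell γ τ) = ((hpR γ τ / (2 * Real.pi) : ℝ) : ℂ) *
      ∫ θ in (0:ℝ)..(2 * Real.pi), F (hpZ θ) * (hpW γ τ θ : ℂ) := by
  have hpi := Real.pi_pos
  unfold huaPickrell circleAC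
  change ∫ z, F z ∂(Measure.map hpZ _) = _
  rw [integral_map hpZ_meas.aemeasurable hF.aestronglyMeasurable,
    integral_withDensity_eq_integral_toReal_smul (hpWeight_meas γ τ) (by simp),
    integral_congr_ae (hp_dens τ hγ _), intervalIntegral.integral_of_le (by positivity),
    integral_Icc_eq_integral_Ioc, integral_const_mul]

lemma hp_integrable {γ : ℝ} (τ : ℝ) (hγ : -(1/2) < γ) {F : ℂ → ℂ} (hF : Continuous F) :
    Integrable F (huaPickrell γ τ) := by
  have hpi := Real.pi_pos
  unfold huaPickrell circleAC
  change Integrable F (Measure.map hpZ _)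
  rw [integrable_map_measure hF.aestronglyMeasurable hpZ_meas.aemeasurable,
    integrable_withDensity_iff_integrable_smul' (hpWeight_meas γ τ) (by simp),
    integrable_congr (hp_dens τ hγ _)]
  apply Integrable.const_mul
  have := hpWc_integrable (τ := τ) hγ (hF.comp hpZ_cont)
  rw [intervalIntegrable_iff_integrableOn_Icc_of_le (by positivity)] at this
  exact this

/-- Pochhammer -/
def hpP (x : ℂ) (k : ℕ) : ℂ := (ascPochhammer ℂ k).eval x

lemma hpP_zero (x : ℂ) : hpP x 0 = 1 := by simp [hpP]
lemma hpP_succ (x : ℂ) (k : ℕ) : hpP x (k + 1) = hpP x k * (x + k) := ascPochhammer_succ_eval k x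
lemma hpP_add (x : ℂ) (j k : ℕ) : hpP x (j + k) = hpP x j * hpP (x + j) k := by
  induction k with
  | zero => simp [hpP_zero]
  | succ k ih => rw [← add_assoc, hpP_succ, hpP_succ, ih]; push_cast; ring
lemma hpP_succ' (x : ℂ) (k : ℕ) : hpP x (k + 1) = x * hpP (x + 1) k := by
  rw [add_comm, hpP_add]; simp [hpP_succ, hpP_zero]
lemma hpP_ne {x : ℂ} (hx : 0 < x.re) (k : ℕ) : hpP x k ≠ 0 := by
  induction k with
  | zero => simp [hpP_zero]
  | succ k ih =>
    rw [hpP_succ]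
    refine mul_ne_zero ih fun h => ?_
    have := congrArg Complex.re h
    simp at this
    have : (0:ℝ) ≤ k := k.cast_nonneg
    linarith

lemma hp_alt (n : ℕ) (f : ℕ → ℂ) :
    ∑ k ∈ Finset.range (n + 2), (-1) ^ k * ((n + 1).choose k : ℂ) * f k =
    ∑ k ∈ Finset.range (n + 1), (-1) ^ k * (n.choose k : ℂ) * (f k - f (k + 1)) := by
  have h1 : ∑ k ∈ Finset.range (n + 1), (-1) ^ k * (n.choose k : ℂ) * f k =
      ∑ k ∈ Finset.range (n + 1), (-1) ^ (k + 1) * (n.choose (k + 1) : ℂ) * f (k + 1) + f 0 := by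
    have := Finset.sum_range_succ (fun k => (-1) ^ k * (n.choose k : ℂ) * f k) (n + 1)
    rw [Nat.choose_succ_self, Finset.sum_range_succ'] at this
    simp only [Nat.cast_zero, mul_zero, zero_mul, add_zero] at this
    rw [← this]; simp
  rw [Finset.sum_range_succ']
  simp only [mul_sub, Finset.sum_sub_distrib, h1]
  simp only [Nat.choose_succ_succ, Nat.cast_add, mul_add, add_mul, Finset.sum_add_distrib]
  simp only [pow_succ, mul_neg, neg_mul, mul_one, Finset.sum_neg_distrib]
  simp
  ring

lemma hp_chu (n : ℕ) : ∀ (a d : ℂ), 0 < d.re →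
    ∑ k ∈ Finset.range (n + 1), (-1) ^ k * (n.choose k : ℂ) * (hpP a k / hpP d k) =
      hpP (d - a) n / hpP d n := by
  induction n with
  | zero => intro a d _; simp [hpP_zero]
  | succ n ih =>
    intro a d hd
    have hd1 : 0 < (d + 1).re := by simp; linarith
    have hd0 : d ≠ 0 := by rintro rfl; simp at hd
    rw [hp_alt]
    have : ∀ k, hpP a k / hpP d k - hpP a (k + 1) / hpP d (k + 1) =
        (d - a) / d * (hpP a k / hpP (d + 1) k) := by
      intro k
      have e : d * hpP (d + 1) k = hpP d k * (d + k) := by rw [← hpP_succ', hpP_succ]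
      have n1 := hpP_ne hd k
      have n2 := hpP_ne hd1 k
      have n3 : d + k ≠ 0 := by
        intro h
        rw [h, mul_zero] at e
        exact mul_ne_zero hd0 n2 e
      have e' : hpP (d + 1) k = hpP d k * (d + k) / d := by
        field_simp; linear_combination e
      rw [hpP_succ, hpP_succ, e']
      field_simp
      ring
    simp only [this]
    have h2 := ih a (d + 1) hd1
    have h3 : ∀ k, (-1:ℂ) ^ k * (n.choose k : ℂ) * ((d - a) / d * (hpP a k / hpP (d + 1) k))
        = (d - a) / d * ((-1) ^ k * (n.choose k : ℂ) * (hpP a k / hpP (d + 1) k)) := by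
      intro k; ring
    simp only [h3]
    rw [← Finset.mul_sum, h2, hpP_succ', hpP_succ', show d + 1 - a = d - a + 1 by ring]
    field_simp

lemma hp_moment {γ : ℝ} (τ : ℝ) (hγ : -(1/2) < γ) (j k : ℕ) :
    ∫ z, (1 - z) ^ j * (1 - conj z) ^ k ∂(huaPickrell γ τ) =
      hpP (2 * γ + 1) (j + k) /
        (hpP (1 + γ + Complex.I * τ) j * hpP (1 + γ - Complex.I * τ) k) := by
  have hpi := Real.pi_pos
  rw [hp_integral τ hγ (by fun_prop)]
  simp only [hpZ_conj]
  change _ * hpU γ τ j k = _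
  have r1 : 0 < (1 + (γ:ℂ) + Complex.I * τ).re := by simp; linarith
  have r2 : 0 < (1 + (γ:ℂ) - Complex.I * τ).re := by simp; linarith
  induction j with
  | zero =>
    induction k with
    | zero =>
      rw [hpU_zero, ← Complex.ofReal_mul, div_mul_eq_mul_div, hpG τ hγ]
      simp [hpP_zero, hpi.ne']
    | succ k ih =>
      have h := hpU_rec' (τ := τ) hγ 0 k
      have n2 := hpP_ne r2 (k + 1)
      have n1 := hpP_ne r2 k
      rw [hpP_zero, zero_add] at ih ⊢
      rw [eq_div_iff (by simpa using n1)] at ih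
      rw [eq_div_iff (by simpa using n2), hpP_succ, hpP_succ, ← ih]
      push_cast at h ⊢
      linear_combination ((hpR γ τ:ℂ) / (2 * Real.pi)) * hpP (1 + γ - Complex.I * τ) k * h
  | succ j ih =>
    have h := hpU_rec (τ := τ) hγ j k
    have n0 := hpP_ne r2 k
    have n2 := hpP_ne r1 (j + 1)
    have n1 := hpP_ne r1 j
    rw [eq_div_iff (mul_ne_zero n1 n0)] at ih
    rw [eq_div_iff (mul_ne_zero n2 n0), show j + 1 + k = j + k + 1 by ring, hpP_succ, hpP_succ, ← ih]
    push_cast at h ⊢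
    linear_combination ((hpR γ τ:ℂ) / (2 * Real.pi)) * hpP (1 + γ + Complex.I * τ) j
       * hpP (1 + γ - Complex.I * τ) k * h



lemma hpP_conj (x : ℂ) (k : ℕ) : conj (hpP x k) = hpP (conj x) k := by
  induction k with
  | zero => simp [hpP_zero]
  | succ k ih => rw [hpP_succ, hpP_succ, map_mul, ih]; simp

lemma hpP_one (n : ℕ) : hpP 1 n = n.factorial := by
  induction n with
  | zero => simp [hpP_zero]
  | succ n ih => rw [hpP_succ, ih, Nat.factorial_succ]; push_cast; ring

lemma hpP_vanish (j n : ℕ) (h1 : 1 ≤ j) (h2 : j ≤ n) : hpP (1 - j) n = 0 := by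
  obtain ⟨i, rfl⟩ : ∃ i, j = i + 1 := ⟨j - 1, by omega⟩
  obtain ⟨r, rfl⟩ := Nat.exists_eq_add_of_le h2
  rw [hpP_add, hpP_succ]
  push_cast
  ring

def hpa (γ τ : ℝ) (n k : ℕ) : ℂ :=
  hpP (2 * γ + 1 + 1) n / n.factorial *
    ((-1) ^ k * (n.choose k : ℂ) * (hpP (1 + γ + Complex.I * τ) k / hpP (2 * γ + 1 + 1) k))

def hpq (γ τ : ℝ) (n : ℕ) : Polynomial ℂ :=
  ∑ k ∈ Finset.range (n + 1), Polynomial.C (hpa γ τ n k) * (1 - Polynomial.X) ^ k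

lemma hpq_one (γ τ : ℝ) (n : ℕ) :
    (hpq γ τ n).eval 1 = hpP (2 * γ + 1 + 1) n / n.factorial := by
  rw [hpq, Polynomial.eval_finsetSum, Finset.sum_range_succ']
  simp [hpa, hpP_zero]

lemma hpq_deg (γ τ : ℝ) (n : ℕ) : (hpq γ τ n).natDegree ≤ n := by
  apply Polynomial.natDegree_sum_le_of_forall_le
  intro k hk
  have hk' : k ≤ n := by simpa [Nat.lt_succ_iff] using hk
  refine (Polynomial.natDegree_C_mul_le _ _).trans ?_
  refine Polynomial.natDegree_pow_le.trans ?_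
  have : (1 - Polynomial.X : Polynomial ℂ).natDegree ≤ 1 := by
    rw [show (1 : Polynomial ℂ) = Polynomial.C 1 from rfl]
    compute_degree
  nlinarith

lemma hpq_conj (γ τ : ℝ) (n : ℕ) (z : ℂ) : conj ((hpq γ τ n).eval z) =
    ∑ k ∈ Finset.range (n + 1), conj (hpa γ τ n k) * (1 - conj z) ^ k := by
  simp [hpq, Polynomial.eval_finsetSum]

lemma hpq_rep_pow {γ : ℝ} (τ : ℝ) (hγ : -(1/2) < γ) (n j : ℕ) (hj : j ≤ n) :
    ∫ z, (1 - z) ^ j * conj ((hpq γ τ n).eval z) ∂(huaPickrell γ τ) = if j = 0 then 1 else 0 := by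
  have r1 : 0 < (1 + (γ:ℂ) + Complex.I * τ).re := by simp; linarith
  have r2 : 0 < (1 + (γ:ℂ) - Complex.I * τ).re := by simp; linarith
  have r3 : 0 < (2 * (γ:ℂ) + 1 + 1).re := by simp; linarith
  have hn : (n.factorial : ℂ) ≠ 0 := by exact_mod_cast n.factorial_ne_zero
  have e1 : ∀ z : ℂ, (1 - z) ^ j * conj ((hpq γ τ n).eval z) =
      ∑ k ∈ Finset.range (n + 1), conj (hpa γ τ n k) * ((1 - z) ^ j * (1 - conj z) ^ k) := by
    intro z
    rw [hpq_conj, Finset.mul_sum]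
    exact Finset.sum_congr rfl fun k _ => by ring
  simp only [e1]
  rw [integral_finsetSum _ (fun k _ => hp_integrable τ hγ (by fun_prop))]
  simp only [integral_const_mul, hp_moment τ hγ]
  have e2 : ∀ k, conj (hpa γ τ n k) = hpP (2 * γ + 1 + 1) n / n.factorial *
    ((-1) ^ k * (n.choose k : ℂ) * (hpP (1 + γ - Complex.I * τ) k / hpP (2 * γ + 1 + 1) k)) := by
    intro k
    have a1 : conj (2 * (γ:ℂ) + 1 + 1) = 2 * (γ:ℂ) + 1 + 1 := by
      simp [Complex.conj_ofReal, Complex.conj_ofNat]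
    have a2 : conj (1 + (γ:ℂ) + Complex.I * τ) = 1 + (γ:ℂ) - Complex.I * τ := by
      simp [Complex.conj_ofReal]; ring
    simp only [hpa, map_mul, map_div₀, hpP_conj, a1, a2, map_natCast, map_pow, map_neg, map_one]
  have e3 : ∀ k, conj (hpa γ τ n k) * (hpP (2 * γ + 1) (j + k) /
        (hpP (1 + γ + Complex.I * τ) j * hpP (1 + γ - Complex.I * τ) k)) =
      (hpP (2 * γ + 1 + 1) n / n.factorial * (hpP (2 * γ + 1) j / hpP (1 + γ + Complex.I * τ) j)) *
      ((-1) ^ k * (n.choose k : ℂ) * (hpP (2 * γ + 1 + j) k / hpP (2 * γ + 1 + 1) k)) := by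
    intro k
    have n1 := hpP_ne r1 j
    have n2 := hpP_ne r2 k
    have n3 := hpP_ne r3 k
    rw [e2, hpP_add]
    field_simp
  simp only [e3]
  rw [← Finset.mul_sum, hp_chu n _ _ r3, show 2 * (γ:ℂ) + 1 + 1 - (2 * γ + 1 + j) = 1 - j by ring]
  have n3 := hpP_ne r3 n
  split_ifs with h
  · subst h
    simp [hpP_zero, hpP_one]
    field_simp
  · rw [hpP_vanish j n (by omega) hj]; simp

lemma hpq_rep {γ : ℝ} (τ : ℝ) (hγ : -(1/2) < γ) (n : ℕ) (P : Polynomial ℂ) (hP : P.natDegree ≤ n) :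
    ∫ z, P.eval z * conj ((hpq γ τ n).eval z) ∂(huaPickrell γ τ) = P.eval 1 := by
  set Q := P.comp (1 - Polynomial.X) with hQ
  have hQd : Q.natDegree < n + 1 := by
    have : (1 - Polynomial.X : Polynomial ℂ).natDegree ≤ 1 := by
      rw [show (1 : Polynomial ℂ) = Polynomial.C 1 from rfl]
      compute_degree
    have h2 : Q.natDegree ≤ _ := Polynomial.natDegree_comp_le
    nlinarith
  have hev : ∀ z, P.eval z = ∑ j ∈ Finset.range (n + 1), Q.coeff j * (1 - z) ^ j := by
    intro z
    rw [← Polynomial.eval_eq_sum_range' hQd, hQ, Polynomial.eval_comp]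
    simp
  have hc : Continuous fun z => conj ((hpq γ τ n).eval z) :=
    Complex.continuous_conj.comp (hpq γ τ n).continuous
  have e1 : ∀ z : ℂ, P.eval z * conj ((hpq γ τ n).eval z) =
      ∑ j ∈ Finset.range (n + 1), Q.coeff j * ((1 - z) ^ j * conj ((hpq γ τ n).eval z)) := by
    intro z
    rw [hev, Finset.sum_mul]
    exact Finset.sum_congr rfl fun k _ => by ring
  simp only [e1]
  rw [integral_finsetSum _ (fun k _ => hp_integrable τ hγ (by fun_prop))]
  simp only [integral_const_mul]
  rw [hev, Finset.sum_range_succ', Finset.sum_range_succ', hpq_rep_pow τ hγ n 0 (Nat.zero_le _)]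
  simp only [if_pos, pow_zero, sub_self]
  congr 1
  apply Finset.sum_congr rfl
  intro k hk
  rw [hpq_rep_pow τ hγ n (k + 1) (by simpa using hk)]
  simp

lemma hp_expand (φ : ℕ → Polynomial ℂ) (hd : ∀ n, (φ n).natDegree = n)
    (hl : ∀ n, (φ n).leadingCoeff ≠ 0) (n : ℕ) : ∀ q : Polynomial ℂ, q.natDegree < n →
    ∃ a : ℕ → ℂ, q = ∑ i ∈ Finset.range n, Polynomial.C (a i) * φ i := by
  induction n with
  | zero => intro q hq; omega
  | succ n ih =>
    intro q hq
    set r := q - Polynomial.C (q.coeff n / (φ n).leadingCoeff) * φ n with hr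
    have hrc : r.coeff n = 0 := by
      have : (φ n).coeff n = (φ n).leadingCoeff := by rw [Polynomial.leadingCoeff, hd]
      rw [hr, Polynomial.coeff_sub, Polynomial.coeff_C_mul, this, div_mul_cancel₀ _ (hl n), sub_self]
    have hrd : r.natDegree ≤ n := by
      refine (Polynomial.natDegree_sub_le _ _).trans (max_le (by omega) ?_)
      exact (Polynomial.natDegree_C_mul_le _ _).trans (hd n).le
    have : ∃ a : ℕ → ℂ, r = ∑ i ∈ Finset.range n, Polynomial.C (a i) * φ i := by
      rcases Nat.eq_zero_or_pos n with h0 | h0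
      · subst h0
        refine ⟨fun _ => 0, ?_⟩
        rw [Polynomial.eq_C_of_natDegree_le_zero hrd, hrc]; simp
      · apply ih
        refine lt_of_le_of_ne hrd fun h => ?_
        have h3 : r.leadingCoeff = 0 := by rw [Polynomial.leadingCoeff, h, hrc]
        rw [Polynomial.leadingCoeff_eq_zero] at h3
        rw [h3] at h; simp at h; omega
    obtain ⟨a, ha⟩ := this
    refine ⟨fun i => if i = n then q.coeff n / (φ n).leadingCoeff else a i, ?_⟩
    have h4 : ∑ i ∈ Finset.range n, Polynomial.C (if i = n then q.coeff n / (φ n).leadingCoeff else a i)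
        * φ i = r := by
      rw [ha]
      apply Finset.sum_congr rfl
      intro i hi
      rw [if_neg (by simp at hi; omega)]
    rw [Finset.sum_range_succ]
    simp only [if_true]
    rw [h4, hr]
    ring

lemma hp_kernel {γ : ℝ} (τ : ℝ) (hγ : -(1/2) < γ)
    (φ : ℕ → Polynomial ℂ) (κ : ℕ → ℝ)
    (hON : IsOrthonormalPolys (huaPickrell γ τ) φ κ) (n : ℕ) :
    repKernel φ n 1 1 = hpP (2 * γ + 1 + 1) n / n.factorial := by
  have hl : ∀ n, (φ n).leadingCoeff ≠ 0 := by
    intro n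
    rw [hON.lead_eq]
    exact_mod_cast (hON.lead_pos n).ne'
  obtain ⟨a, ha⟩ := hp_expand φ hON.natDegree_eq hl (n + 1) (hpq γ τ n)
    (Nat.lt_succ_of_le (hpq_deg γ τ n))
  have hcoef : ∀ j ∈ Finset.range (n + 1), conj (a j) = (φ j).eval 1 := by
    intro j hj
    rw [← hpq_rep τ hγ n (φ j) (by rw [hON.natDegree_eq]; simpa [Nat.lt_succ_iff] using hj), ha]
    have e1 : ∀ z : ℂ, (φ j).eval z *
        conj ((∑ i ∈ Finset.range (n + 1), Polynomial.C (a i) * φ i).eval z) =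
        ∑ i ∈ Finset.range (n + 1), conj (a i) * ((φ j).eval z * conj ((φ i).eval z)) := by
      intro z
      rw [Polynomial.eval_finsetSum, map_sum, Finset.mul_sum]
      refine Finset.sum_congr rfl fun k _ => ?_
      simp; ring
    simp only [e1]
    have hc : ∀ i, Continuous fun z => conj ((φ i).eval z) := fun i =>
      Complex.continuous_conj.comp (φ i).continuous
    rw [integral_finsetSum _ (fun k _ => hp_integrable τ hγ (by
      have := hc k
      have := (φ j).continuous
      fun_prop))]
    simp only [integral_const_mul, hON.orthonormal]
    simp [Finset.mem_range.1 hj]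
  rw [← hpq_one γ τ n, ha, Polynomial.eval_finsetSum, repKernel]
  refine Finset.sum_congr rfl fun j hj => ?_
  rw [← hcoef j hj, Complex.conj_conj]
  simp only [Polynomial.eval_mul, Polynomial.eval_C]
  rw [← hcoef j hj]; ring

lemma hpP_real (x : ℝ) (hx : 0 < x) (n : ℕ) :
    hpP ((x:ℂ) + 1) n = (((∏ j ∈ Finset.range (n + 1), (x + (j:ℝ))) / x : ℝ) : ℂ) := by
  have h : (x:ℂ) ≠ 0 := by exact_mod_cast hx.ne'
  push_cast
  rw [eq_div_iff h, mul_comm, ← hpP_succ']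
  generalize n + 1 = m
  induction m with
  | zero => simp [hpP_zero]
  | succ m ih => rw [hpP_succ, Finset.prod_range_succ, ih]

end HP


/-- **Lemma 2.1.** Diagonal asymptotics of the reproducing kernel at `1` for the
Hua–Pickrell measure. -/
theorem statement_4
    (γ τ : ℝ) (hγ : -(1/2) < γ)
    (φ : ℕ → Polynomial ℂ) (κ : ℕ → ℝ)
    (hON : IsOrthonormalPolys (huaPickrell γ τ) φ κ) :
    Tendsto
      (fun n : ℕ =>
        (Real.Gamma (2 * γ + 2) : ℂ) * repKernel φ n 1 1 / (((n : ℝ) ^ (2 * γ + 1) : ℝ) : ℂ))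
      atTop (𝓝 1) := by
  have hc : 0 < 2 * γ + 1 := by linarith
  have hG := (Real.Gamma_pos_of_pos hc).ne'
  have h1 := (tendsto_const_nhds (x := Real.Gamma (2 * γ + 1))).div
    (Real.GammaSeq_tendsto_Gamma (2 * γ + 1)) hG
  rw [div_self hG] at h1
  have h2 := (Complex.continuous_ofReal.tendsto 1).comp h1
  rw [Complex.ofReal_one] at h2
  refine h2.congr' ?_
  filter_upwards [eventually_gt_atTop 0] with n hn
  have hn' : (0:ℝ) < n := by exact_mod_cast hn
  rw [hp_kernel τ hγ φ κ hON n]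
  have e := hpP_real (2 * γ + 1) hc n
  push_cast at e
  rw [e, show 2 * γ + 2 = (2 * γ + 1) + 1 by ring, Real.Gamma_add_one hc.ne']
  change ((Real.Gamma (2 * γ + 1) / ((n:ℝ) ^ (2 * γ + 1) * n.factorial /
    ∏ j ∈ Finset.range (n + 1), (2 * γ + 1 + (j:ℝ))) : ℝ) : ℂ) = _
  have g1 : (0:ℝ) < (n:ℝ) ^ (2 * γ + 1) := by positivity
  have g2 : (0:ℝ) < n.factorial := by exact_mod_cast n.factorial_pos
  have : Real.Gamma (2 * γ + 1) / ((n:ℝ) ^ (2 * γ + 1) * n.factorial /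
      ∏ j ∈ Finset.range (n + 1), (2 * γ + 1 + (j:ℝ))) =
      (2 * γ + 1) * Real.Gamma (2 * γ + 1) * ((∏ j ∈ Finset.range (n + 1), (2 * γ + 1 + (j:ℝ))) /
        (2 * γ + 1) / n.factorial) / (n:ℝ) ^ (2 * γ + 1) := by
    field_simp
  rw [this]
  push_cast
  ring
end

section
/- Let y = γ + iτ with τ ∈ ℝ and γ > −1/2. For every compact set K ⊂ ℂ there is a constant C_K > 0 such that for every a ∈ K, every n ∈ ℕ, and every m ∈ {0,1,…,n}, |₂F₁(−m, 1+y; 2γ+1; 1−e^{ia/n})| ≤ ₂F₁(−n, 1+|y|; 2γ+1; −C_K/n). -/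
open MeasureTheory Filter Set Topology ComplexConjugate

theorem aux_norm_risingFac (y : ℂ) (k : ℕ) :
    ‖risingFac (1 + y) k‖ ≤ risingFacR (1 + ‖y‖) k := by
  unfold risingFac risingFacR
  induction k with
  | zero => simp
  | succ k ih =>
    rw [ascPochhammer_succ_eval, ascPochhammer_succ_eval, norm_mul]
    have h1 : ‖1 + y + (k : ℂ)‖ ≤ 1 + ‖y‖ + (k : ℝ) := by
      refine (norm_add_le _ _).trans ?_
      have h2 := norm_add_le (1 : ℂ) y
      rw [norm_one] at h2
      rw [Complex.norm_natCast]
      linarith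
    exact mul_le_mul ih h1 (norm_nonneg _) ((norm_nonneg _).trans ih)

theorem aux_risingFac_ofReal (d : ℝ) (k : ℕ) :
    risingFac (d : ℂ) k = ((risingFacR d k : ℝ) : ℂ) := by
  unfold risingFac risingFacR
  induction k with
  | zero => simp
  | succ k ih =>
    rw [ascPochhammer_succ_eval, ascPochhammer_succ_eval, ih]
    push_cast
    ring

/-- **Lemma 2.2.** A uniform bound for terminating hypergeometric sums. -/
theorem statement_5
    (γ τ : ℝ) (hγ : -(1/2) < γ)
    (y : ℂ) (hy : y = (γ:ℂ) + Complex.I * (τ:ℂ)) :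
    ∀ K : Set ℂ, IsCompact K → ∃ C : ℝ, 0 < C ∧
      ∀ a ∈ K, ∀ n : ℕ, 0 < n → ∀ m : ℕ, m ≤ n →
        ‖twoF1t m (1 + y) (2 * (γ:ℂ) + 1)
            (1 - Complex.exp (Complex.I * a / (n:ℂ)))‖
          ≤ twoF1tR n (1 + ‖y‖) (2 * γ + 1) (-(C / (n:ℝ))) := by
  intro K hK
  obtain ⟨R, hR⟩ := hK.isBounded.exists_norm_le
  have hM : (0:ℝ) < |R| + 1 := by positivity
  refine ⟨(|R| + 1) * Real.exp (|R| + 1), by positivity, ?_⟩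
  intro a ha n hn m hm
  have hn1 : (1:ℝ) ≤ n := by exact_mod_cast hn
  have haM : ‖a‖ ≤ |R| + 1 := by
    have := hR a ha
    have := le_abs_self R
    linarith
  have hz : ‖Complex.I * a / (n:ℂ)‖ ≤ (|R| + 1) / n := by
    rw [norm_div, norm_mul, Complex.norm_I, one_mul, Complex.norm_natCast]
    gcongr
  have hz2 : ‖Complex.I * a / (n:ℂ)‖ ≤ |R| + 1 :=
    hz.trans (div_le_self hM.le hn1)
  have hx : ‖-(1 - Complex.exp (Complex.I * a / (n:ℂ)))‖
      ≤ (|R| + 1) * Real.exp (|R| + 1) / n := by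
    have h := Complex.norm_exp_sub_sum_le_norm_mul_exp (Complex.I * a / (n:ℂ)) 1
    simp only [Finset.sum_range_one, pow_zero, Nat.factorial_zero, Nat.cast_one, div_one,
      pow_one] at h
    rw [neg_sub]
    refine h.trans ?_
    rw [mul_div_right_comm (|R| + 1)]
    gcongr
  have hd : (0:ℝ) < 2 * γ + 1 := by linarith
  have hdc : (2 * (γ:ℂ) + 1) = ((2 * γ + 1 : ℝ) : ℂ) := by push_cast; ring
  have hc : (0:ℝ) < 1 + ‖y‖ := by positivity
  unfold twoF1t twoF1tR
  rw [hdc, neg_neg]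
  refine (norm_sum_le _ _).trans ?_
  have hsub : Finset.range (m + 1) ⊆ Finset.range (n + 1) := by
    intro k hk
    simp only [Finset.mem_range] at hk ⊢
    omega
  have hdp : ∀ k, 0 < risingFacR (2 * γ + 1) k := fun k => ascPochhammer_pos k _ hd
  have hcp : ∀ k, 0 < risingFacR (1 + ‖y‖) k := fun k => ascPochhammer_pos k _ hc
  refine (Finset.sum_le_sum ?_).trans (Finset.sum_le_sum_of_subset_of_nonneg hsub ?_)
  · intro k _
    rw [norm_mul, norm_mul, norm_div, norm_pow, Complex.norm_natCast, aux_risingFac_ofReal,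
      Complex.norm_real, Real.norm_of_nonneg (hdp k).le]
    have h1 := aux_norm_risingFac y k
    have h2 : m.choose k ≤ n.choose k := Nat.choose_le_choose k hm
    have h3 := hdp k
    have h4 := hcp k
    gcongr
  · intro k _ _
    have h3 := hdp k
    have h4 := hcp k
    positivity
end

section
/- Fix γ > −1/2 and τ ∈ ℝ, and let μ̃ be the Hua–Pickrell measure. For every compact set K ⊂ ℂ there is a constant C > 0 such that |K_n(e^{ia/n}, e^{ib/n}; μ̃)| ≤ C·K_n(1,1; μ̃) for all a, b ∈ K and all n ∈ ℕ; in particular the functions (a,b) ↦ K_n(e^{ia/n}, e^{i b̄/n}; μ̃)/K_n(1,1; μ̃) form a normal family on ℂ². -/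
open MeasureTheory Filter Set Topology ComplexConjugate

lemma hp_cexp_sub_one (θ : ℝ) : Complex.exp (Complex.I * θ) - 1 =
    2 * Complex.I * (Real.sin (θ/2) : ℝ) * Complex.exp (Complex.I * (θ/2)) := by
  have h1 : Complex.exp (Complex.I * θ) = Complex.exp (Complex.I * (θ/2)) * Complex.exp (Complex.I * (θ/2)) := by
    rw [← Complex.exp_add]; congr 1; ring
  have h2 : Complex.exp (-(Complex.I * (θ/2))) * Complex.exp (Complex.I * (θ/2)) = 1 := by
    rw [← Complex.exp_add]; simp
  have h3 : ((Real.sin (θ/2) : ℝ) : ℂ) =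
      (Complex.exp (-(Complex.I * (θ/2))) - Complex.exp (Complex.I * (θ/2))) * Complex.I / 2 := by
    push_cast [Complex.ofReal_sin]
    rw [Complex.sin]
    congr 4 <;> ring_nf
  rw [h3, h1]
  linear_combination (-Complex.I ^ 2) * h2 + (Complex.exp (Complex.I * (θ/2)) * Complex.exp (Complex.I * (θ/2)) - 1) * Complex.I_sq

lemma hp_cos (θ : ℝ) : (Complex.exp (Complex.I * θ) + 1) =
    2 * (Real.cos (θ/2) : ℝ) * Complex.exp (Complex.I * (θ/2)) := by
  have h1 : Complex.exp (Complex.I * θ) = Complex.exp (Complex.I * (θ/2)) * Complex.exp (Complex.I * (θ/2)) := by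
    rw [← Complex.exp_add]; congr 1; ring
  have h2 : Complex.exp (-(Complex.I * (θ/2))) * Complex.exp (Complex.I * (θ/2)) = 1 := by
    rw [← Complex.exp_add]; simp
  have h3 : ((Real.cos (θ/2) : ℝ) : ℂ) =
      (Complex.exp (-(Complex.I * (θ/2))) + Complex.exp (Complex.I * (θ/2))) / 2 := by
    push_cast [Complex.ofReal_cos]
    rw [Complex.cos, add_comm]
    congr 3 <;> ring_nf
  rw [h3, h1]
  linear_combination - h2

lemma hp_weight_deriv (γ τ θ : ℝ) (hs : 0 < Real.sin (θ/2)) :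
    HasDerivAt (hpWeight γ τ)
      (hpWeight γ τ θ * (-τ + γ * (Real.cos (θ/2) / Real.sin (θ/2)))) θ := by
  unfold hpWeight
  have h1 : HasDerivAt (fun θ : ℝ => Real.exp ((Real.pi - θ) * τ))
      (Real.exp ((Real.pi - θ) * τ) * ((-1) * τ)) θ := by
    exact ((((hasDerivAt_id θ).const_sub Real.pi).mul_const τ)).exp
  have h2 : HasDerivAt (fun θ : ℝ => Real.sin (θ/2)) (Real.cos (θ/2) * (1/2)) θ :=
    ((hasDerivAt_id θ).div_const 2).sin
  have h3 := h2.rpow_const (p := 2 * γ) (Or.inl hs.ne')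
  have h4 := (h1.const_mul ((4:ℝ) ^ γ * ‖Complex.Gamma (1 + (γ:ℂ) + Complex.I * (τ:ℂ))‖ ^ 2
      / Real.Gamma (2 * γ + 1))).mul h3
  refine h4.congr_deriv ?_
  rw [Real.rpow_sub_one hs.ne']
  field_simp

/-- the moments -/
noncomputable def hpJ (γ τ : ℝ) (k m : ℕ) : ℂ :=
  ∫ θ in (0:ℝ)..(2 * Real.pi), (Complex.exp (Complex.I * θ) - 1) ^ k *
    (Complex.exp (-(Complex.I * θ)) - 1) ^ m * (hpWeight γ τ θ : ℂ)

lemma hp_G_cont (γ τ : ℝ) (hγ : -(1/2) < γ) :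
    ContinuousOn (fun θ : ℝ => (Complex.exp (Complex.I * θ) - 1) * (hpWeight γ τ θ : ℂ))
      (Icc 0 (2 * Real.pi)) := by
  have : ContinuousOn (fun θ : ℝ => 2 * Complex.I * Complex.exp (Complex.I * (θ/2)) *
     (((4:ℝ) ^ γ * ‖Complex.Gamma (1 + (γ:ℂ) + Complex.I * (τ:ℂ))‖ ^ 2
      / Real.Gamma (2 * γ + 1)
    * Real.exp ((Real.pi - θ) * τ) * Real.sin (θ / 2) ^ (2 * γ + 1) : ℝ) : ℂ))
      (Icc 0 (2 * Real.pi)) := by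
    apply Continuous.continuousOn
    have h : Continuous (fun θ : ℝ => Real.sin (θ / 2) ^ (2 * γ + 1)) := by
      apply Continuous.rpow_const (by fun_prop)
      intro x; right; linarith
    fun_prop
  refine this.congr ?_
  intro θ hθ
  have hs : 0 ≤ Real.sin (θ/2) := by
    apply Real.sin_nonneg_of_nonneg_of_le_pi <;> linarith [hθ.1, hθ.2]
  simp only
  rw [hp_cexp_sub_one, hpWeight, Real.rpow_add_one' hs (by linarith)]
  push_cast
  ring

lemma hp_rec (γ τ : ℝ) (hγ : -(1/2) < γ)
    (hint : IntervalIntegrable (hpWeight γ τ) volume 0 (2 * Real.pi)) (k m : ℕ) :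
    ((k:ℂ) + 1 + γ + Complex.I * τ) * hpJ γ τ (k+1) m +
      (k + 1 + m + 2 * γ) * hpJ γ τ k m = 0 := by
  have hint' : IntervalIntegrable (fun θ => (hpWeight γ τ θ : ℂ)) volume 0 (2 * Real.pi) :=
    ⟨hint.1.ofReal, hint.2.ofReal⟩
  have hI : ∀ k m : ℕ, IntervalIntegrable (fun θ : ℝ => (Complex.exp (Complex.I * θ) - 1) ^ k *
    (Complex.exp (-(Complex.I * θ)) - 1) ^ m * (hpWeight γ τ θ : ℂ)) volume 0 (2 * Real.pi) := by
    intro k m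
    apply hint'.continuousOn_mul
    fun_prop
  have key := intervalIntegral.integral_eq_sub_of_hasDerivAt_of_le (a := 0) (b := 2 * Real.pi)
    (f := fun θ : ℝ => (Complex.exp (Complex.I * θ) - 1) ^ (k+1) *
      (Complex.exp (-(Complex.I * θ)) - 1) ^ m * (hpWeight γ τ θ : ℂ))
    (f' := fun θ : ℝ => Complex.I * ((k:ℂ) + 1 + γ + Complex.I * τ) *
        ((Complex.exp (Complex.I * θ) - 1) ^ (k+1) *
          (Complex.exp (-(Complex.I * θ)) - 1) ^ m * (hpWeight γ τ θ : ℂ)) +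
      Complex.I * (k + 1 + m + 2 * γ) * ((Complex.exp (Complex.I * θ) - 1) ^ k *
          (Complex.exp (-(Complex.I * θ)) - 1) ^ m * (hpWeight γ τ θ : ℂ)))
    (by positivity) ?_ ?_ ?_
  · rw [intervalIntegral.integral_add ((hI _ _).const_mul _) ((hI _ _).const_mul _),
      intervalIntegral.integral_const_mul, intervalIntegral.integral_const_mul] at key
    have e1 : Complex.exp (Complex.I * ((2 * Real.pi : ℝ) : ℂ)) = 1 := by
      rw [mul_comm]; push_cast; exact Complex.exp_two_pi_mul_I
    rw [e1] at key
    simp only [Complex.ofReal_zero, mul_zero, Complex.exp_zero, sub_self, ne_eq, Nat.add_eq_zero_iff, one_ne_zero, and_false, not_false_eq_true, zero_pow, zero_mul] at key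
    have h0 : Complex.I * (((k:ℂ) + 1 + γ + Complex.I * τ) * hpJ γ τ (k+1) m +
      (k + 1 + m + 2 * γ) * hpJ γ τ k m) = 0 := by
      unfold hpJ
      linear_combination key
    exact (mul_eq_zero.mp h0).resolve_left Complex.I_ne_zero
  · have := hp_G_cont γ τ hγ
    have h2 : ContinuousOn (fun θ : ℝ => (Complex.exp (Complex.I * θ) - 1) ^ k *
      (Complex.exp (-(Complex.I * θ)) - 1) ^ m) (Icc 0 (2 * Real.pi)) := by fun_prop
    refine (h2.mul this).congr ?_
    intro θ _
    simp only [Pi.mul_apply]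
    ring
  · intro θ hθ
    have hs : 0 < Real.sin (θ/2) := by
      apply Real.sin_pos_of_pos_of_lt_pi <;> linarith [hθ.1, hθ.2]
    have hw := (hp_weight_deriv γ τ θ hs).ofReal_comp
    have hz : HasDerivAt (fun θ : ℝ => Complex.exp (Complex.I * θ) - 1)
        (Complex.exp (Complex.I * θ) * (Complex.I * 1)) θ :=
      ((Complex.ofRealCLM.hasDerivAt (x := θ)).const_mul Complex.I).cexp.sub_const 1
    have hz' : HasDerivAt (fun θ : ℝ => Complex.exp (-(Complex.I * θ)) - 1)
        (Complex.exp (-(Complex.I * θ)) * (-(Complex.I * 1))) θ :=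
      ((Complex.ofRealCLM.hasDerivAt (x := θ)).const_mul Complex.I).neg.cexp.sub_const 1
    have h := ((hz.pow (k+1)).mul (hz'.pow m)).mul hw
    refine h.congr_deriv ?_
    have c1 := hp_cexp_sub_one θ
    have c2 := hp_cos θ
    have c3 : Complex.exp (-(Complex.I * θ)) * Complex.exp (Complex.I * θ) = 1 := by
      rw [← Complex.exp_add]; simp
    have c4 : (Complex.exp (Complex.I * θ) - 1) * ((Real.cos (θ/2) / Real.sin (θ/2) : ℝ) : ℂ) =
        Complex.I * (Complex.exp (Complex.I * θ) + 1) := by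
      rw [c1, c2]
      have : ((Real.sin (θ/2) : ℝ) : ℂ) ≠ 0 := by exact_mod_cast hs.ne'
      push_cast at this ⊢
      field_simp
    simp only [Pi.pow_apply, Pi.mul_apply]
    push_cast at c4 ⊢
    generalize Complex.exp (Complex.I * θ) = z at *
    generalize Complex.exp (-(Complex.I * θ)) = z' at *
    generalize (hpWeight γ τ θ : ℂ) = W at *
    generalize Complex.cos (θ/2) / Complex.sin (θ/2) = ct at *
    have I2 := Complex.I_sq
    rcases m with _ | m
    · simp
      linear_combination (z-1)^k * W * γ * c4 + (z-1)^(k+1) * W * (-τ) * I2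
    · simp
      linear_combination (z-1)^k * W * γ * (z'-1)^(m+1) * c4 + (z-1)^(k+1) * (z'-1)^(m+1) * W * (-τ) * I2 - (z-1)^k * (m+1) * (z'-1)^m * W * Complex.I * c3
  · exact ((hI _ _).const_mul _).add ((hI _ _).const_mul _)

lemma hp_meas (γ τ : ℝ) : Measurable (hpWeight γ τ) := by
  unfold hpWeight
  have : Measurable (fun θ : ℝ => Real.sin (θ / 2) ^ (2 * γ)) := by
    apply Measurable.pow_const
    fun_prop
  fun_prop

lemma hp_nonneg (γ τ : ℝ) (hγ : -(1/2) < γ) (θ : ℝ) (hθ : θ ∈ Icc 0 (2 * Real.pi)) :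
    0 ≤ hpWeight γ τ θ := by
  have hs : 0 ≤ Real.sin (θ/2) := by
    apply Real.sin_nonneg_of_nonneg_of_le_pi <;> linarith [hθ.1, hθ.2]
  have hG : 0 < Real.Gamma (2 * γ + 1) := Real.Gamma_pos_of_pos (by linarith)
  unfold hpWeight
  positivity

lemma hp_toReal (γ τ : ℝ) (hγ : -(1/2) < γ) (θ : ℝ) (hθ : θ ∈ Icc 0 (2 * Real.pi)) :
    (ENNReal.ofReal (hpWeight γ τ θ / (2 * Real.pi))).toReal = (2 * Real.pi)⁻¹ * hpWeight γ τ θ := by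
  rw [ENNReal.toReal_ofReal]
  · ring
  · have := hp_nonneg γ τ hγ θ hθ
    positivity

lemma hp_integrable_iff (γ τ : ℝ) (hγ : -(1/2) < γ) (f : ℂ → ℂ) (hf : Continuous f) :
    Integrable f (huaPickrell γ τ) ↔ IntegrableOn (fun θ : ℝ => ((2 * Real.pi)⁻¹ * hpWeight γ τ θ : ℝ) •
      f (Complex.exp (Complex.I * θ))) (Icc 0 (2 * Real.pi)) := by
  have hm : Measurable (fun θ : ℝ => ENNReal.ofReal (hpWeight γ τ θ / (2 * Real.pi))) :=
    ((hp_meas γ τ).div_const _).ennreal_ofReal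
  unfold huaPickrell circleAC
  rw [integrable_map_measure hf.aestronglyMeasurable (by fun_prop),
    integrable_withDensity_iff_integrable_smul' hm (by simp)]
  apply integrableOn_congr_fun _ measurableSet_Icc
  intro θ hθ
  simp only [Function.comp]
  rw [hp_toReal γ τ hγ θ hθ]

lemma hp_integral_s6 (γ τ : ℝ) (hγ : -(1/2) < γ) (f : ℂ → ℂ) (hf : Continuous f) :
    ∫ z, f z ∂(huaPickrell γ τ) = ((2 * Real.pi)⁻¹ : ℝ) * ∫ θ in (0:ℝ)..(2 * Real.pi),
      f (Complex.exp (Complex.I * θ)) * (hpWeight γ τ θ : ℂ) := by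
  have hm : Measurable (fun θ : ℝ => ENNReal.ofReal (hpWeight γ τ θ / (2 * Real.pi))) :=
    ((hp_meas γ τ).div_const _).ennreal_ofReal
  unfold huaPickrell circleAC
  rw [integral_map (by fun_prop) hf.aestronglyMeasurable,
    integral_withDensity_eq_integral_toReal_smul hm (by simp),
    intervalIntegral.integral_of_le (by positivity), ← integral_Icc_eq_integral_Ioc,
    ← integral_const_mul]
  apply setIntegral_congr_fun measurableSet_Icc
  intro θ hθ
  simp only
  rw [hp_toReal γ τ hγ θ hθ, Complex.real_smul]
  push_cast
  ring

lemma hp_int (γ τ : ℝ) (hγ : -(1/2) < γ) (φ : ℕ → Polynomial ℂ) (κ : ℕ → ℝ)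
    (hON : IsOrthonormalPolys (huaPickrell γ τ) φ κ) :
    IntervalIntegrable (hpWeight γ τ) volume 0 (2 * Real.pi) := by
  have h00 := hON.orthonormal 0 0
  have hi : Integrable (fun z => (φ 0).eval z * conj ((φ 0).eval z)) (huaPickrell γ τ) := by
    by_contra h
    rw [integral_undef h] at h00
    simp at h00
  rw [hp_integrable_iff γ τ hγ _ (by fun_prop)] at hi
  obtain ⟨c, hc⟩ := Polynomial.natDegree_eq_zero.mp (hON.natDegree_eq 0)
  have hc0 : c ≠ 0 := by
    rintro rfl
    have h1 := hON.lead_eq 0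
    have h2 := hON.lead_pos 0
    rw [← hc] at h1
    simp at h1
    exact h2.ne (by exact_mod_cast h1)
  rw [intervalIntegrable_iff_integrableOn_Icc_of_le (by positivity)]
  have h3 := (hi.const_mul ((2 * Real.pi : ℂ) * (c * conj c)⁻¹)).re
  refine h3.congr (Eventually.of_forall fun θ => ?_)
  simp only [← hc, Polynomial.eval_C]
  have h4 : conj c ≠ 0 := by simpa using hc0
  have h5 : (Real.pi : ℂ) ≠ 0 := by exact_mod_cast Real.pi_ne_zero
  have : (2 * Real.pi : ℂ) * (c * conj c)⁻¹ * (((2 * Real.pi)⁻¹ * hpWeight γ τ θ) • (c * conj c)) =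
      (hpWeight γ τ θ : ℂ) := by
    rw [Complex.real_smul]
    push_cast
    field_simp
  rw [this]
  simp

lemma hp_cont_integrable (γ τ : ℝ) (hγ : -(1/2) < γ)
    (hint : IntervalIntegrable (hpWeight γ τ) volume 0 (2 * Real.pi)) (f : ℂ → ℂ) (hf : Continuous f) :
    Integrable f (huaPickrell γ τ) := by
  rw [hp_integrable_iff γ τ hγ f hf]
  rw [← intervalIntegrable_iff_integrableOn_Icc_of_le (by positivity)]
  have hint' : IntervalIntegrable (fun θ => (hpWeight γ τ θ : ℂ)) volume 0 (2 * Real.pi) :=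
    ⟨hint.1.ofReal, hint.2.ofReal⟩
  have := (hint'.continuousOn_mul (g := fun θ : ℝ => f (Complex.exp (Complex.I * θ)))
    (by fun_prop)).const_mul ((2 * Real.pi : ℂ)⁻¹)
  convert this using 2 with θ
  rw [Complex.real_smul]
  push_cast
  ring

/-- ratio of Pochhammer symbols -/
noncomputable def hpr (c d : ℂ) (k : ℕ) : ℂ := ∏ j ∈ Finset.range k, ((c + j) / (d + j))

/-- explicit orthogonal polynomials -/
noncomputable def hpF (c d : ℂ) (n : ℕ) : Polynomial ℂ :=
  ∑ k ∈ Finset.range (n + 1), Polynomial.C ((n.choose k : ℂ) * hpr c d k) * (Polynomial.X - 1) ^ k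

lemma hpF_eval (c d : ℂ) (n : ℕ) (z : ℂ) :
    (hpF c d n).eval z = ∑ k ∈ Finset.range (n + 1), (n.choose k : ℂ) * hpr c d k * (z - 1) ^ k := by
  simp [hpF, Polynomial.eval_finsetSum]

lemma hpF_one (c d : ℂ) (n : ℕ) : (hpF c d n).eval 1 = 1 := by
  rw [hpF_eval, Finset.sum_range_succ']
  simp [hpr]

lemma hpF_deg (c d : ℂ) (n : ℕ) : (hpF c d n).natDegree ≤ n := by
  apply Polynomial.natDegree_sum_le_of_forall_le
  intro k hk
  refine (Polynomial.natDegree_C_mul_le _ _).trans ?_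
  refine (Polynomial.natDegree_pow_le).trans ?_
  have : (Polynomial.X - 1 : Polynomial ℂ).natDegree = 1 := by
    simpa using Polynomial.natDegree_X_sub_C (1:ℂ)
  rw [this]
  simp at hk
  omega

lemma hp_diff (d : ℂ) (n m : ℕ) (h : m < n) :
    ∑ k ∈ Finset.range (n + 1), (n.choose k : ℂ) * ((-1) ^ k * ∏ i ∈ Finset.range m, (d + k + i)) = 0 := by
  let P : Polynomial ℂ := ∏ i ∈ Finset.range m, (Polynomial.X + Polynomial.C (d + i))
  have hP : P.natDegree < n := by
    refine lt_of_le_of_lt (Polynomial.natDegree_prod_le _ _) ?_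
    simp only [Polynomial.natDegree_X_add_C]
    simpa using h
  have h1 := congrFun (Polynomial.fwdDiff_iter_eq_zero_of_degree_lt hP) 0
  rw [fwdDiff_iter_eq_sum_shift] at h1
  have h2 : ∀ k ∈ Finset.range (n+1), (n.choose k : ℂ) * ((-1) ^ k * ∏ i ∈ Finset.range m, (d + k + i)) =
      (-1)^n * (((-1 : ℤ) ^ (n - k) * n.choose k) • P.eval (0 + k • 1)) := by
    intro k hk
    have hk' : k ≤ n := by simp at hk; omega
    have : (-1 : ℂ)^n = (-1)^(n-k) * (-1)^k := by rw [← pow_add]; congr 1; omega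
    have h3 : ((-1:ℂ)^(n-k))^2 = 1 := by rw [← pow_mul, mul_comm, pow_mul]; simp
    have h4 : P.eval (0 + k • 1) = ∏ i ∈ Finset.range m, (d + k + i) := by
      simp only [P, Polynomial.eval_prod]
      apply Finset.prod_congr rfl
      intro i _
      simp
      ring
    rw [h4, this, zsmul_eq_mul]
    push_cast
    generalize ∏ i ∈ Finset.range m, (d + (k:ℂ) + i) = q
    linear_combination (-(n.choose k : ℂ) * (-1)^k * q) * h3
  rw [Finset.sum_congr rfl h2, ← Finset.mul_sum, h1]
  simp

lemma hp_rJ (c d : ℂ) (m : ℕ) (J : ℕ → ℂ) (hc : ∀ k : ℕ, c + k ≠ 0) (hd : ∀ k : ℕ, d + k ≠ 0)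
    (hJ : ∀ k : ℕ, (c + k) * J (k+1) + (d + k + m) * J k = 0) (k : ℕ) :
    hpr c d k * J k * ∏ i ∈ Finset.range m, (d + i) =
      (-1)^k * J 0 * ∏ i ∈ Finset.range m, (d + k + i) := by
  induction k with
  | zero => simp [hpr]
  | succ k ih =>
    have h1 : (∏ i ∈ Finset.range m, (d + (k + 1 : ℕ) + i)) * (d + k) =
        (∏ i ∈ Finset.range m, (d + k + i)) * (d + k + m) := by
      rw [← Finset.prod_range_succ (fun i : ℕ => d + k + (i:ℂ)), Finset.prod_range_succ']
      congr 1
      · apply Finset.prod_congr rfl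
        intro i _
        push_cast; ring
      · simp
    have h2 : hpr c d (k+1) * (d + k) = hpr c d k * (c + k) := by
      unfold hpr
      rw [Finset.prod_range_succ]
      have := hd k
      field_simp
    apply mul_right_cancel₀ (hd k)
    generalize ∏ i ∈ Finset.range m, (d + (k + 1 : ℕ) + i) = q at *
    generalize ∏ i ∈ Finset.range m, (d + (k:ℂ) + i) = q' at *
    generalize ∏ i ∈ Finset.range m, (d + (i:ℂ)) = p at *
    linear_combination J (k+1) * p * h2 + hpr c d k * p * hJ k - (d+k+m) * ih  - (-1)^(k+1) * J 0 * h1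

lemma hp_span (φ : ℕ → Polynomial ℂ) (h : ∀ n, (φ n).natDegree = n) (h0 : ∀ n, φ n ≠ 0) (n : ℕ)
    (p : Polynomial ℂ) (hp : p.degree < n) :
    ∃ a : ℕ → ℂ, p = ∑ j ∈ Finset.range n, Polynomial.C (a j) * φ j := by
  induction n generalizing p with
  | zero => 
    refine ⟨0, ?_⟩
    simpa using hp
  | succ n ih =>
    have hl : (φ n).coeff n ≠ 0 := by
      have : (φ n).leadingCoeff ≠ 0 := Polynomial.leadingCoeff_ne_zero.mpr (h0 n)
      rwa [Polynomial.leadingCoeff, h n] at this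
    obtain ⟨a, ha⟩ := ih (p - Polynomial.C (p.coeff n / (φ n).coeff n) * φ n) (by
      rw [Polynomial.degree_lt_iff_coeff_zero]
      intro k hk
      rcases hk.eq_or_lt with rfl | hk
      · simp [hl]
      · have h1 : p.coeff k = 0 := by
          rw [Polynomial.degree_lt_iff_coeff_zero] at hp
          exact hp k hk
        have h2 : (φ n).coeff k = 0 := Polynomial.coeff_eq_zero_of_natDegree_lt (by rw [h n]; exact hk)
        simp [h1, h2])
    refine ⟨fun j => if j = n then p.coeff n / (φ n).coeff n else a j, ?_⟩
    rw [Finset.sum_range_succ]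
    simp only [if_true]
    rw [← sub_eq_iff_eq_add, ha]
    apply Finset.sum_congr rfl
    intro j hj
    have : j ≠ n := by simp at hj; omega
    simp [this]

lemma hpF_orth (γ τ : ℝ) (hγ : -(1/2) < γ)
    (hint : IntervalIntegrable (hpWeight γ τ) volume 0 (2 * Real.pi)) (n : ℕ) (q : Polynomial ℂ)
    (hq : q.degree < n) :
    ∫ z, (hpF (1 + γ + Complex.I * τ) (2 * γ + 1) n).eval z * conj (q.eval z) ∂(huaPickrell γ τ) = 0 := by
  have hre : ∀ k : ℕ, (1 + γ + Complex.I * τ + k : ℂ) ≠ 0 := by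
    intro k hk
    have := congrArg Complex.re hk
    simp at this
    have : (0:ℝ) ≤ k := k.cast_nonneg
    linarith
  have hrd : ∀ k : ℕ, (2 * γ + 1 + k : ℂ) ≠ 0 := by
    intro k hk
    have := congrArg Complex.re hk
    simp at this
    have : (0:ℝ) ≤ k := k.cast_nonneg
    linarith
  have base : ∀ m < n, ∫ z, (hpF (1 + γ + Complex.I * τ) (2 * γ + 1) n).eval z * conj ((z - 1)^m)
      ∂(huaPickrell γ τ) = 0 := by
    intro m hm
    simp only [hpF_eval, Finset.sum_mul]
    rw [integral_finsetSum]
    swap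
    · intro i _
      exact hp_cont_integrable γ τ hγ hint _ (by fun_prop)
    have : ∀ k : ℕ, ∫ z : ℂ, (n.choose k : ℂ) * hpr (1 + γ + Complex.I * τ) (2 * γ + 1) k * (z - 1) ^ k * conj ((z - 1)^m)
      ∂(huaPickrell γ τ) = ((2 * Real.pi)⁻¹ : ℝ) * ((n.choose k : ℂ) *
        (hpr (1 + γ + Complex.I * τ) (2 * γ + 1) k * hpJ γ τ k m)) := by
      intro k
      rw [hp_integral_s6 γ τ hγ _ (by fun_prop)]
      congr 1
      rw [← mul_assoc, hpJ, ← intervalIntegral.integral_const_mul]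
      congr 1
      ext θ
      have : conj (Complex.exp (Complex.I * θ)) = Complex.exp (-(Complex.I * θ)) := by
        rw [← Complex.exp_conj]; simp
      simp only [map_pow, map_sub, this, map_one]
      ring
    simp only [this]
    rw [← Finset.mul_sum]
    have hp : ∏ i ∈ Finset.range m, ((2 * γ + 1 : ℂ) + i) ≠ 0 :=
      Finset.prod_ne_zero_iff.mpr fun i _ => hrd i
    apply mul_eq_zero_of_right
    apply (mul_eq_zero.mp _).resolve_right hp
    rw [Finset.sum_mul]
    have hs : ∀ k ∈ Finset.range (n+1), (n.choose k : ℂ) *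
        (hpr (1 + γ + Complex.I * τ) (2 * γ + 1) k * hpJ γ τ k m) * ∏ i ∈ Finset.range m, ((2 * γ + 1 : ℂ) + i)
        = hpJ γ τ 0 m * ((n.choose k : ℂ) * ((-1) ^ k * ∏ i ∈ Finset.range m, ((2 * γ + 1 : ℂ) + k + i))) := by
      intro k _
      have := hp_rJ (1 + γ + Complex.I * τ) (2 * γ + 1) m (fun k => hpJ γ τ k m) hre hrd (by
        intro k
        have := hp_rec γ τ hγ hint k m
        linear_combination this) k
      linear_combination (n.choose k : ℂ) * this
    rw [Finset.sum_congr rfl hs, ← Finset.mul_sum, hp_diff _ _ _ hm, mul_zero]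
  have hX : ∀ n : ℕ, ((Polynomial.X - Polynomial.C 1 : Polynomial ℂ)^n).natDegree = n := by
    intro n
    rw [Polynomial.natDegree_pow, Polynomial.natDegree_X_sub_C, mul_one]
  obtain ⟨a, ha⟩ := hp_span (fun n => (Polynomial.X - Polynomial.C 1 : Polynomial ℂ)^n) hX
    (fun n => pow_ne_zero _ (Polynomial.X_sub_C_ne_zero 1)) n q hq
  have he : ∀ z : ℂ, (hpF (1 + γ + Complex.I * τ) (2 * γ + 1) n).eval z * conj (q.eval z) =
    ∑ m ∈ Finset.range n, conj (a m) * ((hpF (1 + γ + Complex.I * τ) (2 * γ + 1) n).eval z * conj ((z - 1)^m)) := by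
    intro z
    rw [ha]
    simp only [Polynomial.eval_finsetSum, map_sum, Finset.mul_sum]
    apply Finset.sum_congr rfl
    intro m _
    simp
    ring
  simp only [he]
  rw [integral_finsetSum]
  · apply Finset.sum_eq_zero
    intro m hm
    rw [integral_const_mul, base m (by simpa using hm), mul_zero]
  · intro i _
    exact hp_cont_integrable γ τ hγ hint _ (by fun_prop)

lemma hpF_eq (γ τ : ℝ) (hγ : -(1/2) < γ) (φ : ℕ → Polynomial ℂ) (κ : ℕ → ℝ)
    (hON : IsOrthonormalPolys (huaPickrell γ τ) φ κ) (n : ℕ) (z : ℂ) :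
    (φ n).eval z = (φ n).eval 1 * (hpF (1 + γ + Complex.I * τ) (2 * γ + 1) n).eval z := by
  have hint := hp_int γ τ hγ φ κ hON
  have h0 : ∀ n, φ n ≠ 0 := by
    intro n h
    have h1 := hON.lead_eq n
    have h2 := hON.lead_pos n
    rw [h] at h1
    simp at h1
    exact h2.ne (by exact_mod_cast h1)
  set F := hpF (1 + γ + Complex.I * τ) (2 * γ + 1) n with hF
  obtain ⟨a, ha⟩ := hp_span φ hON.natDegree_eq h0 (n+1) F (by
    refine lt_of_le_of_lt Polynomial.degree_le_natDegree ?_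
    have := hpF_deg (1 + γ + Complex.I * τ) (2 * γ + 1) n
    rw [← hF] at this
    exact Nat.cast_lt.mpr (Nat.lt_succ_of_le this))
  have hz : ∀ j < n, a j = 0 := by
    intro j hj
    have h1 := hpF_orth γ τ hγ hint n (φ j) (by
      refine lt_of_le_of_lt Polynomial.degree_le_natDegree ?_
      rw [hON.natDegree_eq]
      exact_mod_cast hj)
    rw [← hF, ha] at h1
    simp only [Polynomial.eval_finsetSum, Finset.sum_mul, Polynomial.eval_mul, Polynomial.eval_C] at h1
    rw [integral_finsetSum] at h1
    · simp only [mul_assoc] at h1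
      simp only [integral_const_mul, hON.orthonormal] at h1
      simp [Finset.sum_ite_eq'] at h1
      exact h1 (by omega)
    · intro i _
      exact hp_cont_integrable γ τ hγ hint _ (by fun_prop)
  have hFn : F = Polynomial.C (a n) * φ n := by
    rw [ha, Finset.sum_range_succ, Finset.sum_eq_zero, zero_add]
    intro j hj
    rw [hz j (by simpa using hj)]
    simp
  have h1 : a n * (φ n).eval 1 = 1 := by
    have := hpF_one (1 + γ + Complex.I * τ) (2 * γ + 1) n
    rw [← hF, hFn] at this
    simpa using this
  rw [hFn]
  simp only [Polynomial.eval_mul, Polynomial.eval_C]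
  linear_combination (-(φ n).eval z) * h1

lemma hpF_bound (c : ℂ) (d : ℝ) (hd : 0 < d) (n : ℕ) (z : ℂ) :
    ‖(hpF c d n).eval z‖ ≤ Real.exp (n * ((‖c‖ / d + 1) * ‖z - 1‖)) := by
  have hr : ∀ k, ‖hpr c d k‖ ≤ (‖c‖ / d + 1) ^ k := by
    intro k
    unfold hpr
    rw [norm_prod]
    calc _ ≤ ∏ j ∈ Finset.range k, (‖c‖ / d + 1) := by
          apply Finset.prod_le_prod
          · intros; positivity
          · intro j _
            have : ‖(d:ℂ) + j‖ = d + j := by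
              rw [show (d:ℂ) + j = ((d + j : ℝ) : ℂ) by push_cast; rfl, Complex.norm_real]
              exact abs_of_nonneg (by positivity)
            rw [norm_div, this, div_le_iff₀ (by positivity)]
            calc ‖c + j‖ ≤ ‖c‖ + j := by
                  refine (norm_add_le _ _).trans ?_
                  simp
              _ ≤ ‖c‖ + j + (‖c‖ / d * j + d) := by
                  have : 0 ≤ ‖c‖ / d * j + d := by positivity
                  linarith
              _ = _ := by field_simp; ring
      _ = _ := by simp
  rw [hpF_eval]
  calc _ ≤ ∑ k ∈ Finset.range (n + 1), (n.choose k : ℝ) * (‖c‖ / d + 1) ^ k * ‖z - 1‖ ^ k := by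
        refine (norm_sum_le _ _).trans (Finset.sum_le_sum fun k _ => ?_)
        rw [norm_mul, norm_mul, norm_pow]
        simp only [Complex.norm_natCast]
        gcongr
        exact hr k
    _ = ((‖c‖ / d + 1) * ‖z - 1‖ + 1) ^ n := by
        rw [add_pow]
        apply Finset.sum_congr rfl
        intro k _
        rw [mul_pow]
        simp
        ring
    _ ≤ (Real.exp ((‖c‖ / d + 1) * ‖z - 1‖)) ^ n := by
        gcongr
        exact Real.add_one_le_exp _
    _ = _ := by rw [← Real.exp_nat_mul]

/-- Uniform boundedness of the normalized reproducing kernels of the Hua–Pickrell measure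
(normality of the family `(a,b) ↦ K_n(e^{ia/n}, e^{i b̄/n}; μ̃)/K_n(1,1; μ̃)`). -/
theorem statement_6
    (γ τ : ℝ) (hγ : -(1/2) < γ)
    (φ : ℕ → Polynomial ℂ) (κ : ℕ → ℝ)
    (hON : IsOrthonormalPolys (huaPickrell γ τ) φ κ) :
    ∀ K : Set ℂ, IsCompact K → ∃ C : ℝ, 0 < C ∧
      ∀ a ∈ K, ∀ b ∈ K, ∀ n : ℕ,
        ‖repKernel φ n (Complex.exp (Complex.I * a / (n:ℂ)))
            (Complex.exp (Complex.I * b / (n:ℂ)))‖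
          ≤ C * (repKernel φ n 1 1).re := by
  intro K hK
  obtain ⟨R, hR⟩ := hK.isBounded.exists_norm_le
  set c : ℂ := 1 + γ + Complex.I * τ with hc
  set d : ℝ := 2 * γ + 1 with hd
  have hd0 : 0 < d := by linarith
  set B : ℝ := ‖c‖ / d + 1 with hB
  have hB0 : 0 ≤ B := by positivity
  set M : ℝ := Real.exp (B * (R * Real.exp R)) with hM
  have hb : ∀ a ∈ K, ∀ n j : ℕ, j ≤ n →
      ‖(φ j).eval (Complex.exp (Complex.I * a / (n:ℂ)))‖ ≤ M * ‖(φ j).eval 1‖ := by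
    intro a ha n j hj
    rw [hpF_eq γ τ hγ φ κ hON j, norm_mul, mul_comm]
    gcongr
    have h1 := hpF_bound c d hd0 j (Complex.exp (Complex.I * a / (n:ℂ)))
    have e1 : (d : ℂ) = 2 * γ + 1 := by rw [hd]; push_cast; rfl
    rw [e1] at h1
    refine h1.trans ?_
    apply Real.exp_le_exp.mpr
    rw [← hB, mul_left_comm]
    refine mul_le_mul_of_nonneg_left ?_ hB0
    have haR := hR a ha
    have hR0 : 0 ≤ R := (norm_nonneg a).trans haR
    rcases Nat.eq_zero_or_pos n with rfl | hn
    · simp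
      positivity
    have hn' : (1:ℝ) ≤ n := by exact_mod_cast hn
    have hx : ‖Complex.I * a / (n:ℂ)‖ ≤ R / n := by
      rw [norm_div, norm_mul]
      simp only [Complex.norm_I, one_mul, Complex.norm_natCast]
      gcongr
    have h2 := Complex.norm_exp_sub_sum_le_norm_mul_exp (Complex.I * a / (n:ℂ)) 1
    simp only [Finset.range_one, Finset.sum_singleton, pow_zero, Nat.factorial_zero, Nat.cast_one, div_one, pow_one] at h2
    have hj' : (j:ℝ) ≤ n := by exact_mod_cast hj
    calc (j:ℝ) * ‖Complex.exp (Complex.I * a / (n:ℂ)) - 1‖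
        ≤ n * (R / n * Real.exp (R / n)) := by
          gcongr
          refine h2.trans ?_
          gcongr
      _ = R * Real.exp (R / n) := by field_simp
      _ ≤ R * Real.exp R := by
          gcongr
          exact div_le_self hR0 hn'
  refine ⟨M ^ 2, by positivity, ?_⟩
  intro a ha b hb' n
  unfold repKernel
  rw [Complex.re_sum, Finset.mul_sum]
  refine (norm_sum_le _ _).trans (Finset.sum_le_sum fun j hj => ?_)
  have hjn : j ≤ n := by simp at hj; omega
  rw [norm_mul, Complex.norm_conj, Complex.mul_conj, Complex.ofReal_re, Complex.normSq_eq_norm_sq]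
  calc _ ≤ (M * ‖(φ j).eval 1‖) * (M * ‖(φ j).eval 1‖) := by
        gcongr
        · exact hb a ha n j hjn
        · exact hb b hb' n j hjn
    _ = _ := by ring
end

section
/- If γ > −1/2, then T(a) ≠ 0 for every a ∈ ℝ, where T(a) = ₁F₁(1+γ;2γ+1;−ia)·₁F₁(2+γ;2γ+2;ia)·(1+γ) − ₁F₁(γ;2γ+1;−ia)·₁F₁(1+γ;2γ+2;ia)·γ. -/
open MeasureTheory Filter Set Topology ComplexConjugate

theorem hs_of {u v : ℕ → ℂ} {s t : ℂ} (h : HasSum v t) (h1 : ∀ k, u k = v k) (h2 : s = t) :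
    HasSum u s := by
  rw [h2, funext h1]; exact h

theorem rf_succ (v : ℂ) (k : ℕ) : risingFac v (k+1) = risingFac v k * (v + k) := by
  simp [risingFac, ascPochhammer_succ_eval]

theorem rf_zero (v : ℂ) : risingFac v 0 = 1 := by simp [risingFac]

theorem rf_succ_left (v : ℂ) (k : ℕ) : risingFac v (k+1) = v * risingFac (v+1) k := by
  induction k with
  | zero => simp [rf_succ, rf_zero]
  | succ k ih => rw [rf_succ, ih, rf_succ]; push_cast; ring

theorem rf_ne (b : ℝ) (hb : 0 < b) (k : ℕ) : risingFac (b:ℂ) k ≠ 0 := by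
  induction k with
  | zero => simp [rf_zero]
  | succ k ih =>
    rw [rf_succ]
    refine mul_ne_zero ih ?_
    have : (b:ℝ) + k ≠ 0 := by positivity
    exact_mod_cast this

theorem rf_conj (v : ℝ) (k : ℕ) : conj (risingFac (v:ℂ) k) = risingFac (v:ℂ) k := by
  induction k with
  | zero => simp [rf_zero]
  | succ k ih => rw [rf_succ, map_mul, ih]; simp

noncomputable def EE (c : ℕ → ℂ) (z : ℂ) : ℂ := ∑' k : ℕ, c k * z ^ k / (Nat.factorial k : ℂ)

def Bdd (c : ℕ → ℂ) : Prop := ∃ K M : ℝ, 0 ≤ K ∧ 0 ≤ M ∧ ∀ k, ‖c k‖ ≤ K * M ^ k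

theorem Bdd.shift {c : ℕ → ℂ} (h : Bdd c) : Bdd (fun k => c (k+1)) := by
  obtain ⟨K, M, hK, hM, h⟩ := h
  refine ⟨K * M, M, by positivity, hM, fun k => ?_⟩
  have := h (k+1)
  rw [pow_succ] at this
  linarith

theorem term_bound {c : ℕ → ℂ} {K M : ℝ} (hK : 0 ≤ K) (hM : 0 ≤ M) (h : ∀ k, ‖c k‖ ≤ K * M ^ k)
    (z : ℂ) (r : ℝ) (hz : ‖z‖ ≤ r) (k : ℕ) :
    ‖c k * z ^ k / (Nat.factorial k : ℂ)‖ ≤ K * ((M * r) ^ k / (Nat.factorial k : ℝ)) := by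
  rw [norm_div, norm_mul, norm_pow, Complex.norm_natCast, mul_pow, ← mul_div_assoc, ← mul_assoc]
  gcongr
  exact h k

theorem Bdd.hasSum {c : ℕ → ℂ} (h : Bdd c) (z : ℂ) :
    HasSum (fun k : ℕ => c k * z ^ k / (Nat.factorial k : ℂ)) (EE c z) := by
  obtain ⟨K, M, hK, hM, h⟩ := h
  refine Summable.hasSum (Summable.of_norm_bounded ?_ (term_bound hK hM h z ‖z‖ le_rfl))
  exact (Real.summable_pow_div_factorial _).mul_left K

theorem Bdd.hasDerivAt {c : ℕ → ℂ} (h : Bdd c) (z : ℂ) :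
    HasDerivAt (EE c) (EE (fun k => c (k+1)) z) z := by
  have hs := h.shift
  have hh := h
  obtain ⟨K, M, hK, hM, hb⟩ := hs
  have key : ∀ w, EE c w = c 0 + ∑' k : ℕ, c (k+1) * w ^ (k+1) / (Nat.factorial (k+1) : ℂ) := by
    intro w
    unfold EE
    rw [(hh.hasSum w).summable.tsum_eq_zero_add]
    simp
  have hfun : EE c = fun w => c 0 + ∑' k : ℕ, c (k+1) * w ^ (k+1) / (Nat.factorial (k+1) : ℂ) :=
    funext key
  rw [hfun]
  refine HasDerivAt.const_add _ ?_
  refine hasDerivAt_tsum_of_isPreconnected (t := Metric.ball (0:ℂ) (‖z‖+1)) (y₀ := 0)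
    (u := fun k => K * ((M * (‖z‖+1)) ^ k / (Nat.factorial k : ℝ)))
    (g' := fun k w => c (k+1) * w ^ k / (Nat.factorial k : ℂ))
    ((Real.summable_pow_div_factorial _).mul_left K) Metric.isOpen_ball
    (convex_ball _ _).isPreconnected ?_ ?_ ?_ ?_ ?_
  · intro k w _
    have := ((hasDerivAt_pow (k+1) w).const_mul (c (k+1))).div_const (Nat.factorial (k+1) : ℂ)
    refine this.congr_deriv ?_
    have h1 : (Nat.factorial k : ℂ) ≠ 0 := by exact_mod_cast Nat.factorial_ne_zero k
    have h2 : ((k:ℂ) + 1) ≠ 0 := by exact_mod_cast Nat.succ_ne_zero k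
    rw [Nat.factorial_succ]; push_cast
    field_simp
    try simp
  · intro k w hw
    exact term_bound hK hM hb w _ (by simpa using (Metric.mem_ball.1 hw).le) k
  · simp; positivity
  · simp [summable_zero]
  · simp

theorem hasSum_mulk {c : ℕ → ℂ} (h : Bdd c) (z : ℂ) :
    HasSum (fun k : ℕ => (k * c k) * z ^ k / (Nat.factorial k : ℂ))
      (z * EE (fun k => c (k+1)) z) := by
  rw [← hasSum_nat_add_iff' 1]
  refine hs_of ((h.shift.hasSum z).mul_left z) ?_ ?_
  · intro k
    have h1 : (Nat.factorial k : ℂ) ≠ 0 := by exact_mod_cast Nat.factorial_ne_zero k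
    have h2 : ((k:ℂ) + 1) ≠ 0 := by exact_mod_cast Nat.succ_ne_zero k
    rw [Nat.factorial_succ]; push_cast
    field_simp
    ring
  · simp

theorem hasSum_mulz {c : ℕ → ℂ} (h : Bdd c) (z : ℂ) :
    HasSum (fun k : ℕ => (k * c (k-1)) * z ^ k / (Nat.factorial k : ℂ))
      (z * EE c z) := by
  rw [← hasSum_nat_add_iff' 1]
  refine hs_of ((h.hasSum z).mul_left z) ?_ ?_
  · intro k
    have h1 : (Nat.factorial k : ℂ) ≠ 0 := by exact_mod_cast Nat.factorial_ne_zero k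
    have h2 : ((k:ℂ) + 1) ≠ 0 := by exact_mod_cast Nat.succ_ne_zero k
    rw [Nat.factorial_succ]; push_cast
    field_simp
    try ring
  · simp

noncomputable def cf (a b : ℂ) (k : ℕ) : ℂ := risingFac a k / risingFac b k

theorem oneF1_eq (a b z : ℂ) : oneF1 a b z = EE (cf a b) z := rfl

theorem cf_bdd (a : ℂ) (b : ℝ) (hb : 0 < b) : Bdd (cf a b) := by
  refine ⟨1, ‖a‖ / b + 1, by norm_num, by positivity, fun k => ?_⟩
  induction k with
  | zero => simp [cf, rf_zero]
  | succ k ih =>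
    have h1 : cf a b (k+1) = cf a b k * ((a + k) / (b + k)) := by
      simp only [cf, rf_succ]; rw [mul_div_mul_comm]
    have h3 : ‖(b:ℂ) + k‖ = b + k := by
      have : (b:ℂ) + k = ((b + k : ℝ) : ℂ) := by push_cast; rfl
      rw [this, Complex.norm_real, Real.norm_of_nonneg (by positivity)]
    have h2 : ‖(a + k) / ((b:ℂ) + k)‖ ≤ ‖a‖ / b + 1 := by
      rw [norm_div, h3, div_le_iff₀ (by positivity)]
      have h4 : ‖a + k‖ ≤ ‖a‖ + k := by
        refine (norm_add_le _ _).trans ?_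
        rw [Complex.norm_natCast]
      have h5 : (‖a‖ / b + 1) * (b + k) = ‖a‖ + k + (‖a‖ / b * k + b) := by
        field_simp; ring
      have : 0 ≤ ‖a‖ / b * k + b := by positivity
      linarith
    rw [h1, norm_mul, pow_succ, ← mul_assoc]
    gcongr

theorem oneF1_conj (a b : ℝ) (z : ℂ) : conj (oneF1 a b z) = oneF1 a b (conj z) := by
  unfold oneF1
  rw [Complex.conj_tsum]
  simp [rf_conj]

theorem oneF1_zero (a b : ℂ) : oneF1 a b 0 = 1 := by
  unfold oneF1
  rw [tsum_eq_single 0]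
  · simp [rf_zero]
  · intro k hk; simp [hk]

theorem cf_shift (a b : ℂ) : (fun k => cf a b (k+1)) = fun k => a / b * cf (a+1) (b+1) k := by
  ext k
  simp only [cf, rf_succ_left]
  rw [mul_div_mul_comm]

theorem EE_shift (a b z : ℂ) : EE (fun k => cf a b (k+1)) z = a / b * oneF1 (a+1) (b+1) z := by
  rw [cf_shift, oneF1_eq, EE, EE, ← tsum_mul_left]
  congr 1; ext k; ring

theorem oneF1_deriv (a : ℂ) (b : ℝ) (hb : 0 < b) (z : ℂ) :
    HasDerivAt (oneF1 a b) (a / b * oneF1 (a+1) (b+1) z) z := by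
  rw [← EE_shift]
  exact (cf_bdd a b hb).hasDerivAt z

theorem relF (γ : ℂ) (b : ℝ) (hb : 0 < b) (z : ℂ) :
    z * (γ / b * oneF1 (γ+1) (b+1) z) = γ * (oneF1 (γ+1) b z - oneF1 γ b z) := by
  rw [← EE_shift]
  refine (hasSum_mulk (cf_bdd γ b hb) z).unique ?_
  refine hs_of ((((cf_bdd (γ+1) b hb).hasSum z).sub ((cf_bdd γ b hb).hasSum z)).mul_left γ) ?_ rfl
  intro k
  have h : (k:ℂ) * risingFac γ k = γ * (risingFac (γ+1) k - risingFac γ k) := by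
    have := rf_succ γ k
    rw [rf_succ_left] at this
    linear_combination -this
  simp only [cf]
  linear_combination (z^k / (Nat.factorial k : ℂ) / risingFac b k) * h

theorem relG (γ : ℝ) (b : ℝ) (hb : 0 < b) (hγ : b = 2 * γ + 1) (z : ℂ) :
    z * ((γ+1) / b * oneF1 (γ+1+1) (b+1) z)
      = γ * oneF1 γ b z - γ * oneF1 (γ+1) b z + z * oneF1 (γ+1) b z := by
  rw [← EE_shift]
  refine (hasSum_mulk (cf_bdd (γ+1) b hb) z).unique ?_
  refine hs_of (((((cf_bdd γ b hb).hasSum z).mul_left (γ:ℂ)).sub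
    (((cf_bdd (γ+1) b hb).hasSum z).mul_left (γ:ℂ))).add (hasSum_mulz (cf_bdd (γ+1) b hb) z)) ?_ rfl
  intro k
  rcases k with _ | k
  · simp [cf, rf_zero]
  · have h1 := rf_ne b hb k
    have h2 := rf_ne b hb (k+1)
    rw [rf_succ] at h2
    have h3 := right_ne_zero_of_mul h2
    have h : ((k+1 : ℕ):ℂ) * cf (γ+1) b (k+1) =
      γ * cf γ b (k+1) - γ * cf (γ+1) b (k+1) + ((k+1:ℕ):ℂ) * cf (γ+1) b k := by
      simp only [cf]
      rw [rf_succ_left (γ:ℂ), rf_succ, rf_succ]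
      field_simp
      rw [hγ]; push_cast; ring
    simp only [Nat.add_sub_cancel]
    linear_combination (z^(k+1) / (Nat.factorial (k+1) : ℂ)) * h

theorem Tfun_eq (γ a b : ℝ) (hb : 0 < b) (hγ : b = 2 * γ + 1) :
    Tfun γ a = b * (conj (oneF1 ((γ:ℂ)+1) b (Complex.I * a)) *
        (((γ:ℂ)+1) / b * oneF1 (γ+1+1) (b+1) (Complex.I * a))
      - conj (oneF1 (γ:ℂ) b (Complex.I * a)) *
        ((γ:ℂ) / b * oneF1 (γ+1) (b+1) (Complex.I * a))) := by
  have hb' : (b:ℂ) ≠ 0 := by exact_mod_cast hb.ne'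
  have e1 : (2 * (γ:ℂ) + 1) = (b:ℂ) := by rw [hγ]; push_cast; rfl
  have e2 : (2 * (γ:ℂ) + 2) = (b:ℂ) + 1 := by rw [← e1]; ring
  have e3 : (1 + (γ:ℂ)) = γ + 1 := by ring
  have e4 : (2 + (γ:ℂ)) = γ + 1 + 1 := by ring
  have c1 := oneF1_conj γ b (Complex.I * a)
  have c2 := oneF1_conj (γ+1) b (Complex.I * a)
  push_cast at c2
  simp only [map_mul, Complex.conj_I, Complex.conj_ofReal] at c1 c2
  rw [c1, c2, Tfun, e1, e2, e3, e4]
  field_simp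

theorem Tfun_neg (γ a : ℝ) : Tfun γ (-a) = conj (Tfun γ a) := by
  have c1 := oneF1_conj γ (2*γ+1)
  have c2 := oneF1_conj (1+γ) (2*γ+1)
  have c3 := oneF1_conj (2+γ) (2*γ+2)
  have c4 := oneF1_conj (1+γ) (2*γ+2)
  push_cast at c1 c2 c3 c4
  simp [Tfun, c1, c2, c3, c4]

theorem Tfun_zero (γ : ℝ) : Tfun γ 0 = 1 := by
  simp [Tfun, oneF1_zero]

theorem Tfun_cont (γ : ℝ) (hγ : -(1/2) < γ) : Continuous (Tfun γ) := by
  have h : ∀ (a : ℂ) (b : ℝ), 0 < b → Continuous (oneF1 a b) := fun a b hb =>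
    continuous_iff_continuousAt.2 fun z => (oneF1_deriv a b hb z).continuousAt
  have h1 : ∀ a : ℂ, Continuous (oneF1 a (2 * (γ:ℂ) + 1)) := fun a => by
    have := h a (2*γ+1) (by linarith); push_cast at this; exact this
  have h2 : ∀ a : ℂ, Continuous (oneF1 a (2 * (γ:ℂ) + 2)) := fun a => by
    have := h a (2*γ+2) (by linarith); push_cast at this; exact this
  have i1 : Continuous fun a : ℝ => -Complex.I * (a:ℂ) := by fun_prop
  have i2 : Continuous fun a : ℝ => Complex.I * (a:ℂ) := by fun_prop
  unfold Tfun
  exact ((((h1 _).comp i1).mul ((h2 _).comp i2)).mul continuous_const).sub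
    ((((h1 _).comp i1).mul ((h2 _).comp i2)).mul continuous_const)

theorem hasDeriv_line (F : ℂ → ℂ) (F' : ℂ) (a : ℝ) (h : HasDerivAt F F' (Complex.I * a)) :
    HasDerivAt (fun t : ℝ => F (Complex.I * t)) (F' * Complex.I) a := by
  have h1 : HasDerivAt (fun t : ℝ => Complex.I * (t:ℂ)) (Complex.I * 1) a :=
    (Complex.ofRealCLM.hasDerivAt (x := a)).const_mul Complex.I
  rw [mul_one] at h1
  exact HasDerivAt.comp a h h1

theorem hasDeriv_re {f : ℝ → ℂ} {f' : ℂ} {a : ℝ} (h : HasDerivAt f f' a) :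
    HasDerivAt (fun t => (f t).re) f'.re a :=
  Complex.reCLM.hasFDerivAt.comp_hasDerivAt a h

theorem hasDeriv_im {f : ℝ → ℂ} {f' : ℂ} {a : ℝ} (h : HasDerivAt f f' a) :
    HasDerivAt (fun t => (f t).im) f'.im a :=
  Complex.imCLM.hasFDerivAt.comp_hasDerivAt a h

theorem Tre_pos (γ : ℝ) (hγ : -(1/2) < γ) (a : ℝ) (ha : 0 < a) : 0 < (Tfun γ a).re := by
  obtain ⟨b, hb⟩ : ∃ b, b = 2 * γ + 1 := ⟨_, rfl⟩
  have hb0 : 0 < b := by linarith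
  set f : ℝ → ℂ := fun t => oneF1 (γ:ℂ) b (Complex.I * t) with hf
  set g : ℝ → ℂ := fun t => oneF1 ((γ:ℂ)+1) b (Complex.I * t) with hg
  set f1 : ℝ → ℂ := fun t => (γ:ℂ) / b * oneF1 (γ+1) (b+1) (Complex.I * t) with hf1
  set g1 : ℝ → ℂ := fun t => ((γ:ℂ)+1) / b * oneF1 (γ+1+1) (b+1) (Complex.I * t) with hg1
  have df : ∀ t, HasDerivAt f (f1 t * Complex.I) t := fun t =>
    hasDeriv_line _ _ t (oneF1_deriv _ b hb0 _)
  have dg : ∀ t, HasDerivAt g (g1 t * Complex.I) t := fun t =>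
    hasDeriv_line _ _ t (oneF1_deriv _ b hb0 _)
  have rf : ∀ t : ℝ, Complex.I * t * f1 t = γ * (g t - f t) := fun t => relF γ b hb0 _
  have rg : ∀ t : ℝ, Complex.I * t * g1 t = γ * f t - γ * g t + Complex.I * t * g t :=
    fun t => relG γ b hb0 hb _
  have hT : ∀ t : ℝ, Tfun γ t = b * (conj (g t) * g1 t - conj (f t) * f1 t) :=
    fun t => Tfun_eq γ t b hb0 hb
  clear_value f g f1 g1
  set R : ℝ → ℝ := fun t => t * ((g t).re ^ 2 + (g t).im ^ 2)
    + 2 * γ * ((f t).im * (g t).re - (f t).re * (g t).im) with hR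
  have q1 : ∀ t : ℝ, -(t * (f1 t).im) = γ * ((g t).re - (f t).re) := fun t => by
    simpa using congrArg Complex.re (rf t)
  have q2 : ∀ t : ℝ, t * (f1 t).re = γ * ((g t).im - (f t).im) := fun t => by
    simpa using congrArg Complex.im (rf t)
  have q3 : ∀ t : ℝ, -(t * (g1 t).im) = γ * (f t).re - γ * (g t).re - t * (g t).im := fun t => by
    simpa [sub_eq_add_neg] using congrArg Complex.re (rg t)
  have q4 : ∀ t : ℝ, t * (g1 t).re = γ * (f t).im - γ * (g t).im + t * (g t).re := fun t => by
    simpa using congrArg Complex.im (rg t)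
  have hTR : ∀ t : ℝ, t * (Tfun γ t).re = b * R t := fun t => by
    rw [hT]
    simp only [hR, Complex.mul_re, Complex.sub_re, Complex.sub_im, Complex.mul_im,
      Complex.conj_re, Complex.conj_im, Complex.ofReal_re, Complex.ofReal_im]
    linear_combination b * ((g t).re * q4 t - (g t).im * q3 t - (f t).re * q2 t
      + (f t).im * q1 t)
  have dR : ∀ t : ℝ, 0 < t → ∃ R', HasDerivAt R R' t ∧
      t * R' = t * ((g t).re ^ 2 + (g t).im ^ 2) - 2 * γ * R t := fun t ht => by
    have a1 := hasDeriv_re (df t)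
    have a2 := hasDeriv_im (df t)
    have a3 := hasDeriv_re (dg t)
    have a4 := hasDeriv_im (dg t)
    refine ⟨_, ((hasDerivAt_id t).mul ((a3.pow 2).add (a4.pow 2))).add
      (((a2.mul a3).sub (a1.mul a4)).const_mul (2*γ)), ?_⟩
    simp [hR]
    linear_combination (2 * t * (g t).re + 2 * γ * (f t).im) * q3 t
      + (2 * t * (g t).im - 2 * γ * (f t).re) * q4 t
      + (-2 * γ * (g t).im) * q1 t + (2 * γ * (g t).re) * q2 t
  have dΦ : ∀ t : ℝ, 0 < t → HasDerivAt (fun t => t ^ (2*γ) * R t)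
      (t ^ (2*γ) * ((g t).re ^ 2 + (g t).im ^ 2)) t := fun t ht => by
    obtain ⟨R', h1, h2⟩ := dR t ht
    refine ((Real.hasDerivAt_rpow_const (p := 2*γ) (Or.inl ht.ne')).mul h1).congr_deriv ?_
    rw [Real.rpow_sub_one ht.ne']
    field_simp
    linear_combination h2
  have hmono : MonotoneOn (fun t => t ^ (2*γ) * R t) (Ioi 0) := by
    refine monotoneOn_of_deriv_nonneg (convex_Ioi 0)
      (fun t ht => (dΦ t ht).continuousAt.continuousWithinAt) ?_ ?_
    · rw [interior_Ioi]
      exact fun t ht => (dΦ t ht).differentiableAt.differentiableWithinAt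
    · rw [interior_Ioi]
      intro t ht
      rw [(dΦ t ht).deriv]
      have : 0 < t := ht
      positivity
  have hev : ∀ᶠ t in 𝓝 (0:ℝ), 0 < (Tfun γ t).re := by
    have hc : Continuous fun t => (Tfun γ t).re := Complex.continuous_re.comp (Tfun_cont γ hγ)
    refine hc.continuousAt.eventually (lt_mem_nhds ?_)
    simp [Tfun_zero]
  obtain ⟨ε, hε, hball⟩ := Metric.eventually_nhds_iff.1 hev
  obtain ⟨e, he0, heε, hea⟩ : ∃ e : ℝ, 0 < e ∧ e < ε ∧ e ≤ a :=
    ⟨min (ε/2) a, by positivity, (min_le_left _ _).trans_lt (by linarith), min_le_right _ _⟩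
  have hTe : 0 < (Tfun γ e).re := hball (by simpa [abs_of_pos he0] using heε)
  have hRe : 0 < R e := by
    have h1 : 0 < b * R e := by rw [← hTR]; positivity
    exact pos_of_mul_pos_right h1 hb0.le
  have hm : e ^ (2*γ) * R e ≤ a ^ (2*γ) * R a := hmono he0 ha hea
  have h2 : 0 < a ^ (2*γ) * R a := lt_of_lt_of_le (by positivity) hm
  have hRa : 0 < R a := pos_of_mul_pos_right h2 (by positivity)
  have h3 : 0 < a * (Tfun γ a).re := by rw [hTR]; positivity
  exact pos_of_mul_pos_right h3 ha.le

/-- **Lemma 2.3.** The function `T` does not vanish on `ℝ`. -/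
theorem statement_7 (γ : ℝ) (hγ : -(1/2) < γ) (a : ℝ) : Tfun γ a ≠ 0 := by
  rcases lt_trichotomy a 0 with h | h | h
  · intro h0
    have h1 := Tre_pos γ hγ (-a) (by linarith)
    rw [Tfun_neg, h0] at h1
    simp at h1
  · rw [h, Tfun_zero]; exact one_ne_zero
  · intro h0
    have h1 := Tre_pos γ hγ a h
    rw [h0] at h1
    simp at h1
end
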